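/- arXiv:1601.07979 — 3 statements merged into one kernel-verified Lean document; each statement's English description precedes it below -/
import Mathlib

section
/- Let (A, α_A) be a finite-dimensional Hom-algebra and (H, α_H) a Hom-coalgebra over a field k, and let Φ : H⊗A → A⊗H be a Hom-entwining map. Let (e_i) be a basis of A with dual basis (e^i) of A*. Then the linear map φ : A*⊗H → H⊗A* defined by φ(f⊗h) = Σ_i f((e_i)_Φ) h^Φ ⊗ e^i is a Hom-cotwistor between the Hom-coalgebras A*^cop and H (in particular φ∘(ᾱ⊗α_H) = (α_H⊗ᾱ)∘φ). -/
open TensorProduct BigOperators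

noncomputable section

variable (k : Type*) [Field k]

section HomDefs

variable {A B C H U X Y Z : Type*}
variable [AddCommGroup A] [Module k A] [AddCommGroup B] [Module k B]
variable [AddCommGroup C] [Module k C] [AddCommGroup H] [Module k H]
variable [AddCommGroup U] [Module k U] [AddCommGroup X] [Module k X]
variable [AddCommGroup Y] [Module k Y] [AddCommGroup Z] [Module k Z]

/-- A Hom-algebra `(A, α, μ, e)` over `k`. -/
def IsHomAlgebra (α : A ≃ₗ[k] A) (μ : A →ₗ[k] A →ₗ[k] A) (e : A) : Prop :=
  (∀ a b, α (μ a b) = μ (α a) (α b)) ∧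
  (∀ a b c, μ (α a) (μ b c) = μ (μ a b) (α c)) ∧
  α e = e ∧ (∀ a, μ e a = α a) ∧ (∀ a, μ a e = α a)

/-- A Hom-coalgebra `(C, α, Δ, ε)` over `k`. -/
def IsHomCoalgebra (α : C ≃ₗ[k] C) (Δ : C →ₗ[k] C ⊗[k] C) (ε : C →ₗ[k] k) : Prop :=
  (∀ c, Δ (α c) = TensorProduct.map α.toLinearMap α.toLinearMap (Δ c)) ∧
  (∀ c, ε (α c) = ε c) ∧
  (∀ c, TensorProduct.map α.toLinearMap Δ (Δ c)
      = TensorProduct.assoc k C C C (TensorProduct.map Δ α.toLinearMap (Δ c))) ∧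
  (∀ c, TensorProduct.lid k C (TensorProduct.map ε (LinearMap.id : C →ₗ[k] C) (Δ c)) = α c) ∧
  (∀ c, TensorProduct.rid k C (TensorProduct.map (LinearMap.id : C →ₗ[k] C) ε (Δ c)) = α c)

/-- A Hom-bialgebra `(H, α, μ, e, Δ, ε)` over `k`. -/
def IsHomBialgebra (α : H ≃ₗ[k] H) (μ : H →ₗ[k] H →ₗ[k] H) (e : H)
    (Δ : H →ₗ[k] H ⊗[k] H) (ε : H →ₗ[k] k) : Prop :=
  IsHomAlgebra k α μ e ∧ IsHomCoalgebra k α Δ ε ∧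
  (∀ a b, Δ (μ a b) = TensorProduct.map (TensorProduct.lift μ) (TensorProduct.lift μ)
      (TensorProduct.tensorTensorTensorComm k H H H H (Δ a ⊗ₜ[k] Δ b))) ∧
  Δ e = e ⊗ₜ[k] e ∧
  (∀ a b, ε (μ a b) = ε a * ε b) ∧
  ε e = 1

/-- A right `A`-Hom-module `(U, αU, act)`. -/
def IsHomModule (αA : A ≃ₗ[k] A) (μ : A →ₗ[k] A →ₗ[k] A) (e : A)
    (αU : U ≃ₗ[k] U) (act : U →ₗ[k] A →ₗ[k] U) : Prop :=
  (∀ u a, αU (act u a) = act (αU u) (αA a)) ∧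
  (∀ u, act u e = αU u) ∧
  (∀ u a b, act (act u a) (αA b) = act (αU u) (μ a b))

/-- A right `H`-Hom-comodule `(U, αU, ρ)`. -/
def IsHomComodule (αH : H ≃ₗ[k] H) (Δ : H →ₗ[k] H ⊗[k] H) (ε : H →ₗ[k] k)
    (αU : U ≃ₗ[k] U) (ρ : U →ₗ[k] U ⊗[k] H) : Prop :=
  (∀ u, ρ (αU u) = TensorProduct.map αU.toLinearMap αH.toLinearMap (ρ u)) ∧
  (∀ u, TensorProduct.map αU.toLinearMap Δ (ρ u)
      = TensorProduct.assoc k U H H (TensorProduct.map ρ αH.toLinearMap (ρ u))) ∧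
  (∀ u, TensorProduct.rid k U (TensorProduct.map (LinearMap.id : U →ₗ[k] U) ε (ρ u)) = αU u)

/-- A Hom-cotwistor `φ : B ⊗ H → H ⊗ B` between Hom-coalgebras `B` and `H`
(conditions (M1)-(M4) together with compatibility with the structure maps). -/
def IsHomCotwistor (αB : B ≃ₗ[k] B) (ΔB : B →ₗ[k] B ⊗[k] B) (εB : B →ₗ[k] k)
    (αH : H ≃ₗ[k] H) (ΔH : H →ₗ[k] H ⊗[k] H) (εH : H →ₗ[k] k)
    (φ : B ⊗[k] H →ₗ[k] H ⊗[k] B) : Prop :=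
  (φ ∘ₗ TensorProduct.map αB.toLinearMap αH.toLinearMap
     = TensorProduct.map αH.toLinearMap αB.toLinearMap ∘ₗ φ) ∧
  -- (M1)
  (TensorProduct.map αH.toLinearMap ΔB ∘ₗ φ
     = (TensorProduct.assoc k H B B).toLinearMap
       ∘ₗ TensorProduct.map φ (LinearMap.id : B →ₗ[k] B)
       ∘ₗ (TensorProduct.assoc k B H B).symm.toLinearMap
       ∘ₗ TensorProduct.map (LinearMap.id : B →ₗ[k] B) φ
       ∘ₗ (TensorProduct.assoc k B B H).toLinearMap
       ∘ₗ TensorProduct.map ΔB αH.toLinearMap) ∧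
  -- (M2)
  (TensorProduct.map ΔH αB.toLinearMap ∘ₗ φ
     = (TensorProduct.assoc k H H B).symm.toLinearMap
       ∘ₗ TensorProduct.map (LinearMap.id : H →ₗ[k] H) φ
       ∘ₗ (TensorProduct.assoc k H B H).toLinearMap
       ∘ₗ TensorProduct.map φ (LinearMap.id : H →ₗ[k] H)
       ∘ₗ (TensorProduct.assoc k B H H).symm.toLinearMap
       ∘ₗ TensorProduct.map αB.toLinearMap ΔH) ∧
  -- (M3)
  ((TensorProduct.lid k B).toLinearMap
      ∘ₗ TensorProduct.map εH (LinearMap.id : B →ₗ[k] B) ∘ₗ φ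
     = (TensorProduct.rid k B).toLinearMap
        ∘ₗ TensorProduct.map (LinearMap.id : B →ₗ[k] B) εH) ∧
  -- (M4)
  ((TensorProduct.rid k H).toLinearMap
      ∘ₗ TensorProduct.map (LinearMap.id : H →ₗ[k] H) εB ∘ₗ φ
     = (TensorProduct.lid k H).toLinearMap
        ∘ₗ TensorProduct.map εB (LinearMap.id : H →ₗ[k] H))

/-- A monoidal Hom-cotwistor between Hom-bialgebras `B` and `H`:
a Hom-cotwistor additionally satisfying (M5) and (M6). -/
def IsMonoidalHomCotwistor (αB : B ≃ₗ[k] B) (μB : B →ₗ[k] B →ₗ[k] B) (eB : B)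
    (ΔB : B →ₗ[k] B ⊗[k] B) (εB : B →ₗ[k] k)
    (αH : H ≃ₗ[k] H) (μH : H →ₗ[k] H →ₗ[k] H) (eH : H)
    (ΔH : H →ₗ[k] H ⊗[k] H) (εH : H →ₗ[k] k)
    (φ : B ⊗[k] H →ₗ[k] H ⊗[k] B) : Prop :=
  IsHomCotwistor k αB ΔB εB αH ΔH εH φ ∧
  -- (M5)
  (TensorProduct.map (TensorProduct.lift μH) (TensorProduct.lift μB)
      ∘ₗ (TensorProduct.tensorTensorTensorComm k H B H B).toLinearMap
      ∘ₗ TensorProduct.map φ φ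
    = φ ∘ₗ TensorProduct.map (TensorProduct.lift μB) (TensorProduct.lift μH)
        ∘ₗ (TensorProduct.tensorTensorTensorComm k B H B H).toLinearMap) ∧
  -- (M6)
  φ (eB ⊗ₜ[k] eH) = eH ⊗ₜ[k] eB

/-- A Hom-entwining map `Φ : H ⊗ A → A ⊗ H` (conditions (E1)-(E4) together
with compatibility with the structure maps); `(H, A, Φ)` is then a
Hom-entwining structure. -/
def IsHomEntwining (αA : A ≃ₗ[k] A) (μ : A →ₗ[k] A →ₗ[k] A) (e : A)
    (αH : H ≃ₗ[k] H) (Δ : H →ₗ[k] H ⊗[k] H) (ε : H →ₗ[k] k)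
    (Φ : H ⊗[k] A →ₗ[k] A ⊗[k] H) : Prop :=
  (TensorProduct.map αA.toLinearMap αH.toLinearMap ∘ₗ Φ
     = Φ ∘ₗ TensorProduct.map αH.toLinearMap αA.toLinearMap) ∧
  -- (E1)
  (TensorProduct.map (TensorProduct.lift μ) αH.toLinearMap
      ∘ₗ (TensorProduct.assoc k A A H).symm.toLinearMap
      ∘ₗ TensorProduct.map (LinearMap.id : A →ₗ[k] A) Φ
      ∘ₗ (TensorProduct.assoc k A H A).toLinearMap
      ∘ₗ TensorProduct.map Φ (LinearMap.id : A →ₗ[k] A)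
    = Φ ∘ₗ TensorProduct.map αH.toLinearMap (TensorProduct.lift μ)
        ∘ₗ (TensorProduct.assoc k H A A).toLinearMap) ∧
  -- (E2)
  (TensorProduct.map αA.toLinearMap Δ ∘ₗ Φ
     = (TensorProduct.assoc k A H H).toLinearMap
       ∘ₗ TensorProduct.map Φ (LinearMap.id : H →ₗ[k] H)
       ∘ₗ (TensorProduct.assoc k H A H).symm.toLinearMap
       ∘ₗ TensorProduct.map (LinearMap.id : H →ₗ[k] H) Φ
       ∘ₗ (TensorProduct.assoc k H H A).toLinearMap
       ∘ₗ TensorProduct.map Δ αA.toLinearMap) ∧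
  -- (E3)
  ((TensorProduct.rid k A).toLinearMap
      ∘ₗ TensorProduct.map (LinearMap.id : A →ₗ[k] A) ε ∘ₗ Φ
     = (TensorProduct.lid k A).toLinearMap
        ∘ₗ TensorProduct.map ε (LinearMap.id : A →ₗ[k] A)) ∧
  -- (E4)
  (∀ h, Φ (h ⊗ₜ[k] e) = e ⊗ₜ[k] h)

/-- A Hom-monoidal entwining datum between Hom-bialgebras `H` (coalgebra side)
and `A` (algebra side): a Hom-entwining map additionally satisfying (E5), (E6). -/
def IsHomMonoidalEntwining (αA : A ≃ₗ[k] A) (μA : A →ₗ[k] A →ₗ[k] A) (eA : A)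
    (ΔA : A →ₗ[k] A ⊗[k] A) (εA : A →ₗ[k] k)
    (αH : H ≃ₗ[k] H) (μH : H →ₗ[k] H →ₗ[k] H) (eH : H)
    (ΔH : H →ₗ[k] H ⊗[k] H) (εH : H →ₗ[k] k)
    (Φ : H ⊗[k] A →ₗ[k] A ⊗[k] H) : Prop :=
  IsHomEntwining k αA μA eA αH ΔH εH Φ ∧
  -- (E5)
  (TensorProduct.map (LinearMap.id : A ⊗[k] A →ₗ[k] A ⊗[k] A) (TensorProduct.lift μH)
      ∘ₗ (TensorProduct.tensorTensorTensorComm k A H A H).toLinearMap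
      ∘ₗ TensorProduct.map Φ Φ
      ∘ₗ (TensorProduct.tensorTensorTensorComm k H H A A).toLinearMap
      ∘ₗ TensorProduct.map
           (TensorProduct.map (αH.toLinearMap ∘ₗ αH.toLinearMap)
             (αH.toLinearMap ∘ₗ αH.toLinearMap)) ΔA
    = TensorProduct.map ΔA (αH.toLinearMap ∘ₗ αH.toLinearMap)
        ∘ₗ Φ ∘ₗ TensorProduct.map (TensorProduct.lift μH) (LinearMap.id : A →ₗ[k] A)) ∧
  -- (E6)
  (∀ a, TensorProduct.lid k H
      (TensorProduct.map εA (LinearMap.id : H →ₗ[k] H) (Φ (eH ⊗ₜ[k] a))) = εA a • eH)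

/-- An `n`-th Hom-entwined module over a Hom-entwining structure `(H, A, Φ)`. -/
def IsHomEntwinedModule (αA : A ≃ₗ[k] A) (μ : A →ₗ[k] A →ₗ[k] A) (e : A)
    (αH : H ≃ₗ[k] H) (Δ : H →ₗ[k] H ⊗[k] H) (ε : H →ₗ[k] k)
    (Φ : H ⊗[k] A →ₗ[k] A ⊗[k] H) (n : ℤ)
    (αU : U ≃ₗ[k] U) (act : U →ₗ[k] A →ₗ[k] U) (ρ : U →ₗ[k] U ⊗[k] H) : Prop :=
  IsHomModule k αA μ e αU act ∧
  IsHomComodule k αH Δ ε αU ρ ∧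
  ∀ u a, ρ (act u a)
    = TensorProduct.map
        (TensorProduct.lift act ∘ₗ
          TensorProduct.map (LinearMap.id : U →ₗ[k] U) αA.toLinearMap)
        ((αH ^ (-n)).toLinearMap)
        ((TensorProduct.assoc k U A H).symm
          (TensorProduct.map (LinearMap.id : U →ₗ[k] U)
            (Φ ∘ₗ TensorProduct.map ((αH ^ (n + 1)).toLinearMap)
               (LinearMap.id : A →ₗ[k] A))
            (TensorProduct.assoc k U H A (ρ u ⊗ₜ[k] a))))

/-- A Hom-Long dimodule over a Hom-bialgebra `H`. -/
def IsHomLongDimodule (αH : H ≃ₗ[k] H) (μ : H →ₗ[k] H →ₗ[k] H) (e : H)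
    (Δ : H →ₗ[k] H ⊗[k] H) (ε : H →ₗ[k] k)
    (αU : U ≃ₗ[k] U) (act : U →ₗ[k] H →ₗ[k] U) (ρ : U →ₗ[k] U ⊗[k] H) : Prop :=
  IsHomModule k αH μ e αU act ∧
  IsHomComodule k αH Δ ε αU ρ ∧
  ∀ u h, ρ (act u h)
    = TensorProduct.map (TensorProduct.lift act) αH.toLinearMap
        ((TensorProduct.assoc k U H H).symm
          (TensorProduct.map (LinearMap.id : U →ₗ[k] U)
            (TensorProduct.comm k H H).toLinearMap
            (TensorProduct.assoc k U H H (ρ u ⊗ₜ[k] αH h))))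

/-- A right `H`-comodule algebra over a Hom-bialgebra `H`. -/
def IsHomComoduleAlgebra (αH : H ≃ₗ[k] H) (μH : H →ₗ[k] H →ₗ[k] H) (eH : H)
    (ΔH : H →ₗ[k] H ⊗[k] H) (εH : H →ₗ[k] k)
    (αA : A ≃ₗ[k] A) (μA : A →ₗ[k] A →ₗ[k] A) (eA : A)
    (ρA : A →ₗ[k] A ⊗[k] H) : Prop :=
  IsHomAlgebra k αA μA eA ∧
  IsHomComodule k αH ΔH εH αA ρA ∧
  (∀ a b, ρA (μA a b) = TensorProduct.map (TensorProduct.lift μA) (TensorProduct.lift μH)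
      (TensorProduct.tensorTensorTensorComm k A H A H (ρA a ⊗ₜ[k] ρA b))) ∧
  ρA eA = eA ⊗ₜ[k] eH

/-- A right `H`-module coalgebra over a Hom-bialgebra `H`. -/
def IsHomModuleCoalgebra (αH : H ≃ₗ[k] H) (μH : H →ₗ[k] H →ₗ[k] H) (eH : H)
    (ΔH : H →ₗ[k] H ⊗[k] H) (εH : H →ₗ[k] k)
    (αC : C ≃ₗ[k] C) (ΔC : C →ₗ[k] C ⊗[k] C) (εC : C →ₗ[k] k)
    (act : C →ₗ[k] H →ₗ[k] C) : Prop :=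
  IsHomCoalgebra k αC ΔC εC ∧
  IsHomModule k αH μH eH αC act ∧
  (∀ c h, ΔC (act c h) = TensorProduct.map (TensorProduct.lift act) (TensorProduct.lift act)
      (TensorProduct.tensorTensorTensorComm k C C H H (ΔC c ⊗ₜ[k] ΔH h))) ∧
  (∀ c h, εC (act c h) = εC c * εH h)

/-- A Hom-Hopf algebra `(H, α, μ, e, Δ, ε, S)` over `k`. -/
def IsHomHopf (αH : H ≃ₗ[k] H) (μ : H →ₗ[k] H →ₗ[k] H) (e : H)
    (Δ : H →ₗ[k] H ⊗[k] H) (ε : H →ₗ[k] k) (S : H →ₗ[k] H) : Prop :=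
  IsHomBialgebra k αH μ e Δ ε ∧
  (∀ h, S (αH h) = αH (S h)) ∧
  (∀ h, TensorProduct.lift μ
      (TensorProduct.map S (LinearMap.id : H →ₗ[k] H) (Δ h)) = ε h • e) ∧
  (∀ h, TensorProduct.lift μ
      (TensorProduct.map (LinearMap.id : H →ₗ[k] H) S (Δ h)) = ε h • e)

/-- A `p`-th right-right Yetter-Drinfeld module over a Hom-Hopf algebra `H`. -/
def IsYetterDrinfeld (αH : H ≃ₗ[k] H) (μ : H →ₗ[k] H →ₗ[k] H) (e : H)
    (Δ : H →ₗ[k] H ⊗[k] H) (ε : H →ₗ[k] k) (S : H →ₗ[k] H) (p : ℤ)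
    (αU : U ≃ₗ[k] U) (act : U →ₗ[k] H →ₗ[k] U) (ρ : U →ₗ[k] U ⊗[k] H) : Prop :=
  IsHomModule k αH μ e αU act ∧
  IsHomComodule k αH Δ ε αU ρ ∧
  ∀ u h, ρ (act u h)
    = TensorProduct.map
        (TensorProduct.lift act ∘ₗ
          TensorProduct.map (LinearMap.id : U →ₗ[k] U) αH.symm.toLinearMap)
        (TensorProduct.lift μ ∘ₗ
          TensorProduct.map (S ∘ₗ (αH ^ (p - 2)).toLinearMap)
            (TensorProduct.lift μ ∘ₗ
              TensorProduct.map αH.symm.toLinearMap ((αH ^ (p - 4)).toLinearMap)))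
        (TensorProduct.tensorTensorTensorComm k U H H (H ⊗[k] H)
          (TensorProduct.map (LinearMap.id : U ⊗[k] H →ₗ[k] U ⊗[k] H)
            (TensorProduct.leftComm k H H H).toLinearMap
            (TensorProduct.tensorTensorTensorComm k U H H (H ⊗[k] H)
              (ρ u ⊗ₜ[k]
                TensorProduct.map (LinearMap.id : H →ₗ[k] H) Δ (Δ h)))))

/-- The smash coproduct comultiplication on `B ⊗ H` induced by
`φ : B ⊗ H → H ⊗ B`: `Δ(b ⊗ h) = (b₁ ⊗ (h₁)^φ) ⊗ ((b₂)^φ ⊗ h₂)`. -/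
def smashComul (φ : B ⊗[k] H →ₗ[k] H ⊗[k] B) (ΔB : B →ₗ[k] B ⊗[k] B)
    (ΔH : H →ₗ[k] H ⊗[k] H) : B ⊗[k] H →ₗ[k] (B ⊗[k] H) ⊗[k] (B ⊗[k] H) :=
  (TensorProduct.assoc k B H (B ⊗[k] H)).symm.toLinearMap
  ∘ₗ TensorProduct.map (LinearMap.id : B →ₗ[k] B)
       (TensorProduct.assoc k H B H).toLinearMap
  ∘ₗ TensorProduct.map (LinearMap.id : B →ₗ[k] B)
       (TensorProduct.map φ (LinearMap.id : H →ₗ[k] H))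
  ∘ₗ TensorProduct.map (LinearMap.id : B →ₗ[k] B)
       (TensorProduct.assoc k B H H).symm.toLinearMap
  ∘ₗ (TensorProduct.assoc k B B (H ⊗[k] H)).toLinearMap
  ∘ₗ TensorProduct.map ΔB ΔH

/-- The smash coproduct counit on `B ⊗ H`: `ε(b ⊗ h) = εB(b) εH(h)`. -/
def smashCounit (εB : B →ₗ[k] k) (εH : H →ₗ[k] k) : B ⊗[k] H →ₗ[k] k :=
  (TensorProduct.lid k k).toLinearMap ∘ₗ TensorProduct.map εB εH

/-- The componentwise product on `B ⊗ H`: `(a ⊗ h)(b ⊗ g) = ab ⊗ hg`. -/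
def smashMul (μB : B →ₗ[k] B →ₗ[k] B) (μH : H →ₗ[k] H →ₗ[k] H) :
    B ⊗[k] H →ₗ[k] B ⊗[k] H →ₗ[k] B ⊗[k] H :=
  (TensorProduct.mk k (B ⊗[k] H) (B ⊗[k] H)).compr₂
    (TensorProduct.map (TensorProduct.lift μB) (TensorProduct.lift μH)
      ∘ₗ (TensorProduct.tensorTensorTensorComm k B H B H).toLinearMap)

/-- Threefold "componentwise comultiplication" `(C⊗C)⊗C → ((C⊗C)⊗C) ⊗ ((C⊗C)⊗C)`
obtained by applying `Δ2` to each factor and pairing the first and second legs. -/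
def convDelta3 (Δ2 : C →ₗ[k] C ⊗[k] C) :
    (C ⊗[k] C) ⊗[k] C →ₗ[k] ((C ⊗[k] C) ⊗[k] C) ⊗[k] ((C ⊗[k] C) ⊗[k] C) :=
  (TensorProduct.tensorTensorTensorComm k (C ⊗[k] C) (C ⊗[k] C) C C).toLinearMap
  ∘ₗ TensorProduct.map (TensorProduct.tensorTensorTensorComm k C C C C).toLinearMap
       (LinearMap.id : C ⊗[k] C →ₗ[k] C ⊗[k] C)
  ∘ₗ TensorProduct.map (TensorProduct.map Δ2 Δ2) Δ2

/-- The map `ξ_{X,Y}(x ⊗ y) = α_X⁻¹(x)·α_H^m(y₍₁₎) ⊗ α_Y⁻¹(y₍₀₎)` for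
Hom-Long dimodules `X`, `Y`. -/
def longXi (m : ℤ) (αH : H ≃ₗ[k] H) (αX : X ≃ₗ[k] X) (αY : Y ≃ₗ[k] Y)
    (act : X →ₗ[k] H →ₗ[k] X) (ρ : Y →ₗ[k] Y ⊗[k] H) : X ⊗[k] Y →ₗ[k] X ⊗[k] Y :=
  TensorProduct.map
      (TensorProduct.lift act ∘ₗ
        TensorProduct.map (LinearMap.id : X →ₗ[k] X) ((αH ^ m).toLinearMap))
      αY.symm.toLinearMap
    ∘ₗ (TensorProduct.assoc k X H Y).symm.toLinearMap
    ∘ₗ TensorProduct.map (LinearMap.id : X →ₗ[k] X) (TensorProduct.comm k Y H).toLinearMap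
    ∘ₗ TensorProduct.map αX.symm.toLinearMap ρ

/-- The associativity constraint `a_{X,Y,Z}((x⊗y)⊗z) = α_X^{i+1}(x) ⊗ (y ⊗ α_Z^{-j-1}(z))`. -/
def homAssoc (i j : ℤ) (αX : X ≃ₗ[k] X) (αZ : Z ≃ₗ[k] Z) :
    (X ⊗[k] Y) ⊗[k] Z ≃ₗ[k] X ⊗[k] (Y ⊗[k] Z) :=
  (TensorProduct.assoc k X Y Z).trans
    (TensorProduct.congr (αX ^ (i + 1))
      (TensorProduct.congr (LinearEquiv.refl k Y) (αZ ^ (-j - 1))))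

/-- The braiding `τ_{X,Y}(x ⊗ y) = α_Y^{j-i-1}(y₍₀₎) ⊗ α_X^{i-j-1}(x)·α_H^{-p}(y₍₁₎)`
for Yetter-Drinfeld modules. -/
def ydTau (p i j : ℤ) (αH : H ≃ₗ[k] H) (αX : X ≃ₗ[k] X) (αY : Y ≃ₗ[k] Y)
    (act : X →ₗ[k] H →ₗ[k] X) (ρ : Y →ₗ[k] Y ⊗[k] H) : X ⊗[k] Y →ₗ[k] Y ⊗[k] X :=
  TensorProduct.map ((αY ^ (j - i - 1)).toLinearMap)
      (TensorProduct.lift act ∘ₗ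
        TensorProduct.map ((αX ^ (i - j - 1)).toLinearMap) ((αH ^ (-p)).toLinearMap))
    ∘ₗ (TensorProduct.leftComm k X Y H).toLinearMap
    ∘ₗ TensorProduct.map (LinearMap.id : X →ₗ[k] X) ρ

end HomDefs
section DualPairing

variable {A H X Y : Type*}
variable [AddCommMonoid A] [Module k A] [AddCommMonoid H] [Module k H]
variable [AddCommMonoid X] [Module k X] [AddCommMonoid Y] [Module k Y]

/-- Evaluation of the dual tensor factor at `a`: `x ⊗ f ↦ f a • x`. -/
def evalRight (X : Type*) [AddCommMonoid X] [Module k X] (a : A) :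
    X ⊗[k] Module.Dual k A →ₗ[k] X :=
  (TensorProduct.rid k X).toLinearMap ∘ₗ TensorProduct.map LinearMap.id (Module.Dual.eval k A a)

/-- Contraction of the left tensor factor by a functional: `a ⊗ x ↦ f a • x`. -/
def contractLeftFactor (X : Type*) [AddCommMonoid X] [Module k X] (f : A →ₗ[k] k) :
    A ⊗[k] X →ₗ[k] X :=
  (TensorProduct.lid k X).toLinearMap ∘ₗ TensorProduct.map f LinearMap.id

@[simp]
lemma evalRight_tmul (a : A) (x : X) (f : Module.Dual k A) :
    evalRight k X a (x ⊗ₜ[k] f) = f a • x := by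
  simp [evalRight]

@[simp]
lemma contractLeftFactor_tmul (f : A →ₗ[k] k) (a : A) (x : X) :
    contractLeftFactor k X f (a ⊗ₜ[k] x) = f a • x := by
  simp [contractLeftFactor]

lemma contractLeftFactor_map (f : A →ₗ[k] k) (p : Y →ₗ[k] A) (g : H →ₗ[k] X)
    (t : Y ⊗[k] H) :
    contractLeftFactor k X f (TensorProduct.map p g t)
      = g (contractLeftFactor k H (f ∘ₗ p) t) := by
  induction t with
  | zero => simp
  | tmul y h => simp
  | add s t hs ht => simp only [map_add, hs, ht]

lemma evalRight_map (g : X →ₗ[k] Y) (p : Module.Dual k A →ₗ[k] Module.Dual k A)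
    (a a' : A) (hp : ∀ f, p f a = f a') (t : X ⊗[k] Module.Dual k A) :
    evalRight k Y a (TensorProduct.map g p t) = g (evalRight k X a' t) := by
  induction t with
  | zero => simp
  | tmul x f => simp [hp]
  | add s t hs ht => simp only [map_add, hs, ht]

lemma sum_evalRight_tmul_dualBasis {ι : Type*} [Fintype ι] [DecidableEq ι]
    (b : Module.Basis ι k A) (t : X ⊗[k] Module.Dual k A) :
    ∑ i, evalRight k X (b i) t ⊗ₜ[k] b.dualBasis i = t := by
  induction t with
  | zero => simp
  | tmul x f =>
    simp only [evalRight_tmul, TensorProduct.smul_tmul, ← TensorProduct.tmul_sum]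
    congr 1
    simp
  | add s t hs ht =>
    simp only [map_add, TensorProduct.add_tmul, Finset.sum_add_distrib, hs, ht]

lemma ext_evalRight {ι : Type*} [Fintype ι] [DecidableEq ι]
    (b : Module.Basis ι k A) {s t : X ⊗[k] Module.Dual k A}
    (h : ∀ a, evalRight k X a s = evalRight k X a t) : s = t := by
  rw [← sum_evalRight_tmul_dualBasis k b s, ← sum_evalRight_tmul_dualBasis k b t]
  simp only [h]

lemma evalRight_sum_tmul_dualBasis {ι : Type*} [Fintype ι] [DecidableEq ι]
    (b : Module.Basis ι k A) (g : A →ₗ[k] X) (a : A) :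
    evalRight k X a (∑ i, g (b i) ⊗ₜ[k] b.dualBasis i) = g a := by
  conv_rhs => rw [← b.sum_repr a, map_sum]
  simp

end DualPairing

section Induced

variable {A H : Type*} [AddCommGroup A] [Module k A] [AddCommGroup H] [Module k H]
variable (Φ : H ⊗[k] A →ₗ[k] A ⊗[k] H)
variable (φ : Module.Dual k A ⊗[k] H →ₗ[k] H ⊗[k] Module.Dual k A)

lemma evalRight_evalRight_map_comul
    (αA : A ≃ₗ[k] A) (μ : A →ₗ[k] A →ₗ[k] A) (αH : H →ₗ[k] H)
    (Δbar : Module.Dual k A →ₗ[k] Module.Dual k A ⊗[k] Module.Dual k A)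
    (hΔbar : ∀ (f : Module.Dual k A) (x y : A),
        TensorProduct.dualDistrib k A A (Δbar f) (x ⊗ₜ[k] y)
          = f (αA.symm (αA.symm (μ y x))))
    (x y : A) (t : H ⊗[k] Module.Dual k A) :
    evalRight k H x (evalRight k _ y ((TensorProduct.assoc k H _ _).symm
        (TensorProduct.map αH Δbar t)))
      = αH (evalRight k H (αA.symm (αA.symm (μ y x))) t) := by
  induction t with
  | zero => simp
  | add s t hs ht => simp only [map_add, hs, ht]
  | tmul h f =>
    rw [TensorProduct.map_tmul, evalRight_tmul, ← hΔbar, map_smul]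
    generalize Δbar f = d
    induction d with
    | zero => simp
    | add s t hs ht =>
      simp only [map_add, TensorProduct.tmul_add, LinearMap.add_apply, add_smul, hs, ht]
    | tmul f g => simp [smul_smul, mul_comm]

variable {Φ φ}

lemma evalRight_evalRight_iterate
    (hev : ∀ f h a, evalRight k H a (φ (f ⊗ₜ[k] h))
      = contractLeftFactor k H f (Φ (h ⊗ₜ[k] a)))
    (x y : A) (d : Module.Dual k A ⊗[k] Module.Dual k A) (h : H) :
    evalRight k H x (evalRight k _ y (TensorProduct.map φ LinearMap.id
        ((TensorProduct.assoc k _ H _).symm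
          (TensorProduct.map LinearMap.id φ (TensorProduct.assoc k _ _ H (d ⊗ₜ[k] h))))))
      = contractLeftFactor k H
          (TensorProduct.dualDistrib k A A d ∘ₗ (TensorProduct.comm k A A).toLinearMap)
          ((TensorProduct.assoc k A A H).symm (TensorProduct.map LinearMap.id Φ
            (TensorProduct.assoc k A H A (Φ (h ⊗ₜ[k] y) ⊗ₜ[k] x)))) := by
  induction d with
  | zero => simp [contractLeftFactor]
  | add s t hs ht =>
    simp only [map_add, TensorProduct.add_tmul, hs, ht]
    simp only [contractLeftFactor, LinearMap.add_comp, TensorProduct.map_add_left,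
      LinearMap.comp_add, LinearMap.add_apply]
  | tmul f g =>
    rw [evalRight_map k φ LinearMap.id y y (fun _ => rfl)]
    have h₁ : ∀ s : H ⊗[k] Module.Dual k A,
        evalRight k _ y ((TensorProduct.assoc k (Module.Dual k A) H (Module.Dual k A)).symm
          (f ⊗ₜ[k] s)) = f ⊗ₜ[k] evalRight k H y s := by
      intro s
      induction s with
      | zero => simp
      | tmul h f => simp
      | add s t hs ht => simp only [map_add, TensorProduct.tmul_add, hs, ht]
    simp only [TensorProduct.assoc_tmul, TensorProduct.map_tmul, LinearMap.id_apply, h₁, hev]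
    generalize Φ (h ⊗ₜ[k] y) = w
    induction w with
    | zero => simp
    | add s t hs ht => simp only [map_add, TensorProduct.add_tmul, hs, ht]
    | tmul a h' =>
      simp only [contractLeftFactor_tmul, TensorProduct.assoc_tmul, TensorProduct.map_tmul,
        LinearMap.id_apply, ← TensorProduct.smul_tmul', map_smul]
      generalize Φ (h' ⊗ₜ[k] x) = v
      induction v with
      | zero => simp
      | add s t hs ht => simp only [map_add, TensorProduct.tmul_add, smul_add, hs, ht]
      | tmul a' h'' => simp [smul_smul, mul_comm]

lemma evalRight_iterate
    (hev : ∀ f h a, evalRight k H a (φ (f ⊗ₜ[k] h))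
      = contractLeftFactor k H f (Φ (h ⊗ₜ[k] a)))
    (a : A) (f : Module.Dual k A) (d : H ⊗[k] H) :
    evalRight k _ a ((TensorProduct.assoc k H H _).symm
        (TensorProduct.map LinearMap.id φ (TensorProduct.assoc k H _ H
          (TensorProduct.map φ LinearMap.id
            ((TensorProduct.assoc k _ H H).symm (f ⊗ₜ[k] d))))))
      = contractLeftFactor k _ f (TensorProduct.assoc k A H H
          (TensorProduct.map Φ LinearMap.id ((TensorProduct.assoc k H A H).symm
            (TensorProduct.map LinearMap.id Φ
              (TensorProduct.assoc k H H A (d ⊗ₜ[k] a)))))) := by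
  induction d with
  | zero => simp
  | add s t hs ht =>
    simp only [map_add, TensorProduct.add_tmul, TensorProduct.tmul_add, hs, ht]
  | tmul g h =>
    have h₁ : ∀ (p : H) (s : H ⊗[k] Module.Dual k A),
        evalRight k _ a ((TensorProduct.assoc k H H (Module.Dual k A)).symm
          (p ⊗ₜ[k] s)) = p ⊗ₜ[k] evalRight k H a s := by
      intro p s
      induction s with
      | zero => simp
      | tmul h f => simp
      | add s t hs ht => simp only [map_add, TensorProduct.tmul_add, hs, ht]
    let L : A ⊗[k] H →ₗ[k] Module.Dual k A →ₗ[k] H :=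
      (LinearMap.rTensorHom H).flip.compr₂ (TensorProduct.lid k H).toLinearMap
    have hL : ∀ v f', L v f' = contractLeftFactor k H f' v := fun _ _ => rfl
    have h₂ : ∀ s : H ⊗[k] Module.Dual k A,
        evalRight k _ a ((TensorProduct.assoc k H H (Module.Dual k A)).symm
          (TensorProduct.map LinearMap.id φ
            (TensorProduct.assoc k H (Module.Dual k A) H (s ⊗ₜ[k] h))))
          = LinearMap.lTensor H (L (Φ (h ⊗ₜ[k] a))) s := by
      intro s
      induction s with
      | zero => simp
      | tmul p f' => simp [h₁, hev, hL]
      | add s t hs ht => simp only [map_add, TensorProduct.add_tmul, hs, ht]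
    have h₃ : ∀ (a' : A) (h' : H) (s : H ⊗[k] Module.Dual k A),
        LinearMap.lTensor H (L (a' ⊗ₜ[k] h')) s = evalRight k H a' s ⊗ₜ[k] h' := by
      intro a' h' s
      induction s with
      | zero => simp
      | tmul p f' => simp [hL, TensorProduct.smul_tmul']
      | add s t hs ht => simp only [map_add, TensorProduct.add_tmul, hs, ht]
    have h₄ : ∀ (w : A ⊗[k] H) (h' : H),
        contractLeftFactor k _ f (TensorProduct.assoc k A H H (w ⊗ₜ[k] h'))
          = contractLeftFactor k H f w ⊗ₜ[k] h' := by
      intro w h'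
      induction w with
      | zero => simp
      | tmul p f' => simp [TensorProduct.smul_tmul']
      | add s t hs ht => simp only [map_add, TensorProduct.add_tmul, hs, ht]
    simp only [TensorProduct.assoc_tmul, TensorProduct.assoc_symm_tmul, TensorProduct.map_tmul,
      LinearMap.id_apply, h₂]
    generalize Φ (h ⊗ₜ[k] a) = v
    induction v with
    | zero => simp
    | tmul a' h' => simp [h₃, h₄, hev]
    | add s t hs ht =>
      simp only [map_add, LinearMap.lTensor_add, LinearMap.add_apply, TensorProduct.tmul_add,
        hs, ht]

end Induced

/-- a Hom-entwining map `Φ : H ⊗ A → A ⊗ H` induces a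
Hom-cotwistor `φ : A* ⊗ H → H ⊗ A*` between `A*^cop` and `H`, given by
`φ(f ⊗ h) = Σ_i f((e_i)_Φ) h^Φ ⊗ e^i`. -/
theorem homEntwining_induces_homCotwistor
    {A H : Type*} [AddCommGroup A] [Module k A] [AddCommGroup H] [Module k H]
    {ι : Type*} [Fintype ι] [DecidableEq ι] (b : Module.Basis ι k A)
    (αA : A ≃ₗ[k] A) (μ : A →ₗ[k] A →ₗ[k] A) (e : A)
    (αH : H ≃ₗ[k] H) (ΔH : H →ₗ[k] H ⊗[k] H) (εH : H →ₗ[k] k)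
    (hA : IsHomAlgebra k αA μ e) (hH : IsHomCoalgebra k αH ΔH εH)
    (Φ : H ⊗[k] A →ₗ[k] A ⊗[k] H)
    (hΦ : IsHomEntwining k αA μ e αH ΔH εH Φ)
    (Δbar : Module.Dual k A →ₗ[k] Module.Dual k A ⊗[k] Module.Dual k A)
    (hΔbar : ∀ (f : Module.Dual k A) (x y : A),
        TensorProduct.dualDistrib k A A (Δbar f) (x ⊗ₜ[k] y)
          = f (αA.symm (αA.symm (μ y x))))
    (φ : Module.Dual k A ⊗[k] H →ₗ[k] H ⊗[k] Module.Dual k A)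
    (hφ : ∀ (f : Module.Dual k A) (h : H),
        φ (f ⊗ₜ[k] h) = ∑ i, (TensorProduct.lid k H
            (TensorProduct.map (f : A →ₗ[k] k) (LinearMap.id : H →ₗ[k] H)
              (Φ (h ⊗ₜ[k] b i)))) ⊗ₜ[k] b.dualBasis i) :
    IsHomCotwistor k αA.symm.dualMap Δbar (Module.Dual.eval k A e) αH ΔH εH φ := by
  obtain ⟨hα, hE1, hE2, hE3, hE4⟩ := hΦ
  have hev : ∀ f h a, evalRight k H a (φ (f ⊗ₜ[k] h))
      = contractLeftFactor k H f (Φ (h ⊗ₜ[k] a)) := by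
    intro f h a
    rw [hφ]
    exact evalRight_sum_tmul_dualBasis k b
      (contractLeftFactor k H f ∘ₗ Φ ∘ₗ TensorProduct.mk k H A h) a
  have hα' : ∀ h a, Φ (αH h ⊗ₜ[k] a) = TensorProduct.map αA.toLinearMap αH.toLinearMap
      (Φ (h ⊗ₜ[k] αA.symm a)) := by
    intro h a
    simpa using (LinearMap.congr_fun hα (h ⊗ₜ[k] αA.symm a)).symm
  refine ⟨?_, ?_, ?_, ?_, ?_⟩
  · refine TensorProduct.ext' fun f h => ext_evalRight k b fun a => ?_
    simp only [LinearMap.comp_apply, TensorProduct.map_tmul]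
    rw [evalRight_map k αH.toLinearMap _ a (αA.symm a) (fun _ => rfl), hev, hev]
    simp only [LinearEquiv.coe_coe]
    rw [hα', contractLeftFactor_map]
    have hf : αA.symm.dualMap f ∘ₗ αA.toLinearMap = f := LinearMap.ext fun x => by simp
    rw [hf]
    rfl
  · refine TensorProduct.ext' fun f h =>
      (TensorProduct.assoc k _ _ _).symm.injective
        (ext_evalRight k b fun y => ext_evalRight k b fun x => ?_)
    simp only [LinearMap.comp_apply, TensorProduct.map_tmul, LinearEquiv.coe_coe,
      LinearEquiv.symm_apply_apply]
    rw [evalRight_evalRight_map_comul k αA μ _ Δbar hΔbar, hev,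
      evalRight_evalRight_iterate k hev]
    have hd : TensorProduct.dualDistrib k A A (Δbar f) ∘ₗ (TensorProduct.comm k A A).toLinearMap
        = (f ∘ₗ αA.symm.toLinearMap ∘ₗ αA.symm.toLinearMap) ∘ₗ TensorProduct.lift μ := by
      refine TensorProduct.ext' fun p q => ?_
      simp [hΔbar]
    have hμ := LinearMap.congr_fun hE1 ((αH h ⊗ₜ[k] y) ⊗ₜ[k] x)
    simp only [LinearMap.comp_apply, TensorProduct.map_tmul, LinearEquiv.coe_coe,
      TensorProduct.assoc_tmul, TensorProduct.lift.tmul, LinearMap.id_apply, hα'] at hμ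
    have hμ' := congrArg (contractLeftFactor k H
      (f ∘ₗ αA.symm.toLinearMap ∘ₗ αA.symm.toLinearMap)) hμ
    simp only [contractLeftFactor_map] at hμ'
    rw [hd, hα']
    refine αH.injective (Eq.symm (hμ'.trans ?_))
    simp only [LinearEquiv.coe_coe]
    congr 4
    ext p
    simp
  · refine TensorProduct.ext' fun f h => ext_evalRight k b fun a => ?_
    simp only [LinearMap.comp_apply, TensorProduct.map_tmul, LinearEquiv.coe_coe]
    rw [evalRight_map k ΔH _ a (αA.symm a) (fun _ => rfl), hev, evalRight_iterate k hev]
    have h2 := LinearMap.congr_fun hE2 (h ⊗ₜ[k] αA.symm a)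
    simp only [LinearMap.comp_apply, TensorProduct.map_tmul, LinearEquiv.coe_coe,
      LinearEquiv.apply_symm_apply] at h2
    rw [← h2, contractLeftFactor_map]
    congr 3
    ext p
    simp
  · refine TensorProduct.ext' fun f h => LinearMap.ext fun a => ?_
    have h3 := congrArg f (LinearMap.congr_fun hE3 (h ⊗ₜ[k] a))
    have h₁ : ∀ t : H ⊗[k] Module.Dual k A,
        TensorProduct.lid k _ (TensorProduct.map εH LinearMap.id t) a
          = εH (evalRight k H a t) := by
      intro t
      induction t with
      | zero => simp
      | tmul p g => simp [mul_comm]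
      | add s t hs ht => simp only [map_add, LinearMap.add_apply, hs, ht]
    have h₂ : ∀ t : A ⊗[k] H,
        f (TensorProduct.rid k _ (TensorProduct.map LinearMap.id εH t))
          = εH (contractLeftFactor k H f t) := by
      intro t
      induction t with
      | zero => simp
      | tmul p g => simp [mul_comm]
      | add s t hs ht => simp only [map_add, hs, ht]
    simp only [LinearMap.comp_apply, LinearEquiv.coe_coe, h₂] at h3
    simp only [LinearMap.comp_apply, LinearEquiv.coe_coe, h₁, hev, h3]
    simp
  · refine TensorProduct.ext' fun f h => ?_
    have h4 := hev f h e
    rw [hE4] at h4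
    simpa [evalRight] using h4
end
end

section
/- Let (A, α_A) be a finite-dimensional Hom-algebra and (H, α_H) a Hom-coalgebra over a field k, and let φ : A*⊗H → H⊗A* be a Hom-cotwistor between the Hom-coalgebras A*^cop and H, written φ(f⊗h) = Σ h^φ ⊗ f^φ. Let (e_i) be a basis of A with dual basis (e^i) of A*. Then the linear map Φ : H⊗A → A⊗H defined by Φ(h⊗a) = Σ_i (e^i)^φ(a) e_i ⊗ h^φ (where (e^i)^φ ⊗ h^φ denotes φ applied to e^i⊗h) is a Hom-entwining map; in particular (α_A⊗α_H)∘Φ = Φ∘(α_H⊗α_A). -/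
open TensorProduct BigOperators

noncomputable section

variable (k : Type*) [Field k]

section Contraction

variable {A X : Type*} [AddCommGroup A] [Module k A] [AddCommGroup X] [Module k X]

/-- Contraction of the right leg of `X ⊗ A*` with a vector: `x ⊗ f ↦ f a • x`. -/
def sliceRight : A →ₗ[k] X ⊗[k] Module.Dual k A →ₗ[k] X :=
  LinearMap.compRight k (TensorProduct.rid k X).toLinearMap ∘ₗ LinearMap.lTensorHom X
    ∘ₗ Module.Dual.eval k A

/-- Contraction of the left leg of `A ⊗ X` with a functional: `a ⊗ x ↦ f a • x`. -/
def sliceLeft : Module.Dual k A →ₗ[k] A ⊗[k] X →ₗ[k] X :=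
  LinearMap.compRight k (TensorProduct.lid k X).toLinearMap ∘ₗ LinearMap.rTensorHom X

@[simp]
theorem sliceRight_tmul (a : A) (x : X) (f : Module.Dual k A) :
    sliceRight k a (x ⊗ₜ[k] f) = f a • x := by
  simp [sliceRight]

@[simp]
theorem sliceLeft_tmul (f : Module.Dual k A) (a : A) (x : X) :
    sliceLeft k f (a ⊗ₜ[k] x) = f a • x := by
  simp [sliceLeft]

theorem sum_tmul_sliceLeft {ι : Type*} [Fintype ι] (b : Module.Basis ι k A)
    (t : A ⊗[k] X) : ∑ i, b i ⊗ₜ[k] sliceLeft k (b.coord i) t = t := by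
  induction t with
  | zero => simp
  | add s t hs ht => simp only [map_add, tmul_add, Finset.sum_add_distrib, hs, ht]
  | tmul a x =>
    simp only [sliceLeft_tmul, ← smul_tmul, ← sum_tmul, b.coord_apply, b.sum_repr]

theorem eq_of_sliceLeft_eq {ι : Type*} [Fintype ι] (b : Module.Basis ι k A)
    {s t : A ⊗[k] X} (h : ∀ f : Module.Dual k A, sliceLeft k f s = sliceLeft k f t) :
    s = t := by
  rw [← sum_tmul_sliceLeft k b s, ← sum_tmul_sliceLeft k b t]
  simp only [h]

theorem sliceLeft_map {B Y : Type*} [AddCommGroup B] [Module k B] [AddCommGroup Y]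
    [Module k Y] (f : Module.Dual k B) (p : A →ₗ[k] B) (q : X →ₗ[k] Y) (t : A ⊗[k] X) :
    sliceLeft k f (TensorProduct.map p q t) = q (sliceLeft k (f ∘ₗ p) t) := by
  induction t with
  | zero => simp
  | add s t hs ht => simp only [map_add, hs, ht]
  | tmul a x => simp

theorem sliceRight_map_dualMap {B Y : Type*} [AddCommGroup B] [Module k B] [AddCommGroup Y]
    [Module k Y] (b : B) (p : B ≃ₗ[k] A) (q : X →ₗ[k] Y) (t : X ⊗[k] Module.Dual k A) :
    sliceRight k b (TensorProduct.map q p.dualMap.toLinearMap t) = q (sliceRight k (p b) t) := by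
  induction t with
  | zero => simp
  | add s t hs ht => simp only [map_add, hs, ht]
  | tmul a x => simp

/-- Contracting the inner legs of `v ∈ X ⊗ A*` and `u ∈ A ⊗ Y` in either order. -/
theorem map_sliceRight_flip {Y : Type*} [AddCommGroup Y] [Module k Y]
    (v : X ⊗[k] Module.Dual k A) (u : A ⊗[k] Y) :
    TensorProduct.map ((sliceRight k).flip v) (LinearMap.id : Y →ₗ[k] Y) u
      = TensorProduct.map (LinearMap.id : X →ₗ[k] X) ((sliceLeft k).flip u) v := by
  induction u with
  | zero => simp
  | add s t hs ht => simp only [map_add, hs, ht, TensorProduct.map_add_right, LinearMap.add_apply]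
  | tmul a y =>
    induction v with
    | zero => simp
    | add s t hs ht =>
      simp only [map_add, TensorProduct.map_add_left, LinearMap.add_apply, hs, ht]
    | tmul x f => simp [smul_tmul]

end Contraction

section Entwining

variable {A H : Type*} [AddCommGroup A] [Module k A] [AddCommGroup H] [Module k H]

/-- The element `(h^{φψ}) f₁^ψ(x) f₂^φ(y)` of `H`, for `D = f₁ ⊗ f₂`. -/
def doubleSlice (φ : Module.Dual k A ⊗[k] H →ₗ[k] H ⊗[k] Module.Dual k A)
    (x y : A) (h : H) : Module.Dual k A ⊗[k] Module.Dual k A →ₗ[k] H :=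
  sliceRight k x ∘ₗ φ ∘ₗ
    TensorProduct.map LinearMap.id
      (sliceRight k y ∘ₗ φ ∘ₗ (TensorProduct.mk k (Module.Dual k A) H).flip h)

variable {φ : Module.Dual k A ⊗[k] H →ₗ[k] H ⊗[k] Module.Dual k A}

@[simp]
theorem doubleSlice_tmul (x y : A) (h : H) (f g : Module.Dual k A) :
    doubleSlice k φ x y h (f ⊗ₜ[k] g)
      = sliceRight k x (φ (f ⊗ₜ[k] sliceRight k y (φ (g ⊗ₜ[k] h)))) := by
  simp [doubleSlice]

/-- Evaluating the right-hand side of (M1) at two vectors. -/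
theorem sliceRight_sliceRight_iterate (x y : A) (h : H)
    (D : Module.Dual k A ⊗[k] Module.Dual k A) :
    sliceRight k x (sliceRight k y ((TensorProduct.assoc k H _ _).symm
      (TensorProduct.assoc k H _ _ (TensorProduct.map φ LinearMap.id
        ((TensorProduct.assoc k _ H _).symm (TensorProduct.map LinearMap.id φ
          (TensorProduct.assoc k _ _ H (D ⊗ₜ[k] h))))))))
      = doubleSlice k φ x y h D := by
  rw [LinearEquiv.symm_apply_apply]
  induction D with
  | zero => simp
  | add s t hs ht => simp only [map_add, add_tmul, hs, ht]
  | tmul f g =>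
    simp only [assoc_tmul, map_tmul, LinearMap.id_apply, doubleSlice_tmul]
    induction φ (g ⊗ₜ[k] h) with
    | zero => simp
    | add s t hs ht => simp only [map_add, tmul_add, hs, ht]
    | tmul h₀ g₀ => simp

/-- Evaluating the left-hand side of (M1) at two vectors. -/
theorem sliceRight_sliceRight_map
    {Δ : Module.Dual k A →ₗ[k] Module.Dual k A ⊗[k] Module.Dual k A}
    {m : A →ₗ[k] A →ₗ[k] A}
    (hΔ : ∀ f x y, TensorProduct.dualDistrib k A A (Δ f) (x ⊗ₜ[k] y) = f (m x y))
    (α : H →ₗ[k] H) (x y : A) (t : H ⊗[k] Module.Dual k A) :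
    sliceRight k x (sliceRight k y ((TensorProduct.assoc k H _ _).symm
      (TensorProduct.map α Δ t))) = α (sliceRight k (m x y) t) := by
  induction t with
  | zero => simp
  | add s t hs ht => simp only [map_add, hs, ht]
  | tmul h f =>
    simp only [map_tmul, sliceRight_tmul, map_smul, ← hΔ]
    induction Δ f with
    | zero => simp
    | add s t hs ht => simp only [map_add, tmul_add, hs, ht, LinearMap.add_apply, add_smul]
    | tmul f g => simp [smul_smul, mul_comm]

variable {Φ : H ⊗[k] A →ₗ[k] A ⊗[k] H}

/-- Evaluating the left-hand side of (E1) at a functional `f`, where `D` is dual to `f (xy)`. -/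
theorem sliceLeft_mul_iterate
    (hΦ : ∀ f h a, sliceLeft k f (Φ (h ⊗ₜ[k] a)) = sliceRight k a (φ (f ⊗ₜ[k] h)))
    (μ : A →ₗ[k] A →ₗ[k] A) (α : H →ₗ[k] H) (f : Module.Dual k A)
    {D : Module.Dual k A ⊗[k] Module.Dual k A}
    (hD : ∀ x y, TensorProduct.dualDistrib k A A D (y ⊗ₜ[k] x) = f (μ x y))
    (h : H) (a c : A) :
    sliceLeft k f (TensorProduct.map (TensorProduct.lift μ) α
      ((TensorProduct.assoc k A A H).symm (TensorProduct.map LinearMap.id Φ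
        (TensorProduct.assoc k A H A (Φ (h ⊗ₜ[k] a) ⊗ₜ[k] c)))))
      = α (doubleSlice k φ c a h D) := by
  have key : ∀ s : A ⊗[k] H,
      sliceLeft k f (TensorProduct.map (TensorProduct.lift μ) α
        ((TensorProduct.assoc k A A H).symm (TensorProduct.map LinearMap.id Φ
          (TensorProduct.assoc k A H A (s ⊗ₜ[k] c)))))
        = α (sliceRight k c (φ (TensorProduct.map LinearMap.id
            ((sliceLeft k).flip s) D))) := by
    intro s
    induction s with
    | zero => simp
    | add s t hs ht =>
      simp only [map_add, add_tmul, hs, ht, TensorProduct.map_add_right, LinearMap.add_apply]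
    | tmul x g =>
      have hx : TensorProduct.map LinearMap.id ((sliceLeft k).flip (x ⊗ₜ[k] g)) D
          = (f ∘ₗ μ x) ⊗ₜ[k] g := by
        have h₁ : f ∘ₗ μ x = sliceRight k x D := by
          ext y
          rw [LinearMap.comp_apply, ← hD]
          clear hD
          induction D with
          | zero => simp
          | add s t hs ht => simp only [map_add, LinearMap.add_apply, hs, ht]
          | tmul p q => simp [mul_comm]
        rw [h₁]
        clear hD h₁
        induction D with
        | zero => simp
        | add s t hs ht => simp only [map_add, add_tmul, hs, ht]
        | tmul p q => simp [smul_tmul]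
      rw [hx, ← hΦ]
      simp only [assoc_tmul, map_tmul, LinearMap.id_apply]
      induction Φ (g ⊗ₜ[k] c) with
      | zero => simp
      | add s t hs ht => simp only [map_add, tmul_add, hs, ht]
      | tmul y g₀ => simp
  have hs : (sliceLeft k).flip (Φ (h ⊗ₜ[k] a)) = sliceRight k a ∘ₗ φ ∘ₗ
      (TensorProduct.mk k (Module.Dual k A) H).flip h :=
    LinearMap.ext fun p => hΦ p h a
  rw [key, hs]
  rfl

/-- Evaluating the right-hand side of (E2) at a functional agrees with evaluating the right-hand
side of (M2) at a vector. -/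
theorem sliceLeft_iterate_eq_sliceRight_iterate
    (hΦ : ∀ f h a, sliceLeft k f (Φ (h ⊗ₜ[k] a)) = sliceRight k a (φ (f ⊗ₜ[k] h)))
    (f : Module.Dual k A) (a : A) (D : H ⊗[k] H) :
    sliceLeft k f (TensorProduct.assoc k A H H (TensorProduct.map Φ LinearMap.id
      ((TensorProduct.assoc k H A H).symm (TensorProduct.map LinearMap.id Φ
        (TensorProduct.assoc k H H A (D ⊗ₜ[k] a))))))
      = sliceRight k a ((TensorProduct.assoc k H H _).symm
        (TensorProduct.map LinearMap.id φ (TensorProduct.assoc k H _ H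
          (TensorProduct.map φ LinearMap.id
            ((TensorProduct.assoc k _ H H).symm (f ⊗ₜ[k] D)))))) := by
  induction D with
  | zero => simp
  | add s t hs ht => simp only [map_add, add_tmul, tmul_add, hs, ht]
  | tmul g h =>
    simp only [assoc_tmul, assoc_symm_tmul, map_tmul, LinearMap.id_apply]
    trans TensorProduct.map ((sliceRight k).flip (φ (f ⊗ₜ[k] g))) LinearMap.id (Φ (h ⊗ₜ[k] a))
    · induction Φ (h ⊗ₜ[k] a) with
      | zero => simp
      | add s t hs ht => simp only [map_add, tmul_add, hs, ht]
      | tmul x w =>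
        simp only [assoc_symm_tmul, map_tmul, LinearMap.id_apply, LinearMap.flip_apply, ← hΦ]
        induction Φ (g ⊗ₜ[k] x) with
        | zero => simp
        | add s t hs ht => simp only [map_add, add_tmul, hs, ht]
        | tmul y w₀ => simp [smul_tmul']
    · rw [map_sliceRight_flip]
      induction φ (f ⊗ₜ[k] g) with
      | zero => simp
      | add s t hs ht => simp only [map_add, add_tmul, hs, ht]
      | tmul w p =>
        simp only [assoc_tmul, map_tmul, LinearMap.id_apply, LinearMap.flip_apply, hΦ]
        induction φ (p ⊗ₜ[k] h) with
        | zero => simp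
        | add s t hs ht => simp only [map_add, tmul_add, hs, ht]
        | tmul w₀ q => simp

end Entwining

/-- a Hom-cotwistor `φ : A* ⊗ H → H ⊗ A*` between `A*^cop` and `H`
induces a Hom-entwining map `Φ(h ⊗ a) = Σ_i (e^i)^φ(a) e_i ⊗ h^φ`. -/
theorem homCotwistor_induces_homEntwining
    {A H : Type*} [AddCommGroup A] [Module k A] [AddCommGroup H] [Module k H]
    {ι : Type*} [Fintype ι] [DecidableEq ι] (b : Module.Basis ι k A)
    (αA : A ≃ₗ[k] A) (μ : A →ₗ[k] A →ₗ[k] A) (e : A)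
    (αH : H ≃ₗ[k] H) (ΔH : H →ₗ[k] H ⊗[k] H) (εH : H →ₗ[k] k)
    (hA : IsHomAlgebra k αA μ e) (hH : IsHomCoalgebra k αH ΔH εH)
    (Δbar : Module.Dual k A →ₗ[k] Module.Dual k A ⊗[k] Module.Dual k A)
    (hΔbar : ∀ (f : Module.Dual k A) (x y : A),
        TensorProduct.dualDistrib k A A (Δbar f) (x ⊗ₜ[k] y)
          = f (αA.symm (αA.symm (μ y x))))
    (φ : Module.Dual k A ⊗[k] H →ₗ[k] H ⊗[k] Module.Dual k A)
    (hφ : IsHomCotwistor k αA.symm.dualMap Δbar (Module.Dual.eval k A e)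
        αH ΔH εH φ)
    (Φ : H ⊗[k] A →ₗ[k] A ⊗[k] H)
    (hΦdef : ∀ (h : H) (a : A),
        Φ (h ⊗ₜ[k] a) = ∑ i, b i ⊗ₜ[k]
          (TensorProduct.rid k H
            (TensorProduct.map (LinearMap.id : H →ₗ[k] H)
              (Module.Dual.eval k A a) (φ (b.dualBasis i ⊗ₜ[k] h))))) :
    IsHomEntwining k αA μ e αH ΔH εH Φ := by
  obtain ⟨hc, hM1, hM2, hM3, hM4⟩ := hφ
  have hΦ : ∀ f h a, sliceLeft k f (Φ (h ⊗ₜ[k] a))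
      = sliceRight k a (φ (f ⊗ₜ[k] h)) := by
    intro f h a
    have hf : f = ∑ i, f (b i) • b.dualBasis i := by
      refine b.ext fun j => ?_
      simp
    conv_rhs => rw [hf]
    rw [hΦdef, map_sum, sum_tmul, map_sum, map_sum]
    refine Finset.sum_congr rfl fun i _ => ?_
    rw [sliceLeft_tmul, ← smul_tmul', map_smul, map_smul]
    rfl
  have hdual : ∀ f : Module.Dual k A,
      αA.symm.dualMap (f ∘ₗ αA.toLinearMap) = f := by
    intro f; ext x; simp
  have hα : ∀ (f : Module.Dual k A) (h : H) (a : A),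
      αH (sliceRight k a (φ ((f ∘ₗ αA.toLinearMap) ⊗ₜ[k] h)))
        = sliceRight k (αA a) (φ (f ⊗ₜ[k] αH h)) := by
    intro f h a
    have := LinearMap.congr_fun hc ((f ∘ₗ αA.toLinearMap) ⊗ₜ[k] h)
    simp only [LinearMap.comp_apply, map_tmul, LinearEquiv.coe_coe, hdual] at this
    rw [this]
    have h₂ := sliceRight_map_dualMap k (αA a) αA.symm αH.toLinearMap
      (φ ((f ∘ₗ αA.toLinearMap) ⊗ₜ[k] h))
    simpa using h₂.symm
  refine ⟨?_, ?_, ?_, ?_, ?_⟩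
  · refine TensorProduct.ext' fun h a => eq_of_sliceLeft_eq k b fun f => ?_
    simp only [LinearMap.comp_apply, map_tmul, sliceLeft_map, hΦ, LinearEquiv.coe_coe]
    exact hα f h a
  · refine TensorProduct.ext_threefold fun h a c => eq_of_sliceLeft_eq k b fun f => ?_
    simp only [LinearMap.comp_apply, map_tmul, LinearEquiv.coe_coe, LinearMap.id_apply,
      assoc_tmul, lift.tmul, hΦ]
    let g := f ∘ₗ αA.toLinearMap
    let D := TensorProduct.map (αA.toLinearMap.dualMap) (αA.toLinearMap.dualMap) (Δbar g)
    have hD : ∀ x y, TensorProduct.dualDistrib k A A D (y ⊗ₜ[k] x) = f (μ x y) := by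
      intro x y
      trans TensorProduct.dualDistrib k A A (Δbar g) (αA y ⊗ₜ[k] αA x)
      · simp only [D]
        induction Δbar g with
        | zero => simp
        | add s t hs ht => simp only [map_add, LinearMap.add_apply, hs, ht]
        | tmul p q => simp
      · rw [hΔbar, ← hA.1]
        simp [g]
    rw [sliceLeft_mul_iterate k hΦ μ αH.toLinearMap f hD]
    have hW : ∀ E, αH (doubleSlice k φ c a h
        (TensorProduct.map (αA.toLinearMap.dualMap) (αA.toLinearMap.dualMap) E))
        = doubleSlice k φ (αA c) (αA a) (αH h) E := by
      intro E
      induction E with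
      | zero => simp
      | add s t hs ht => simp only [map_add, hs, ht]
      | tmul p q =>
        simp only [map_tmul, doubleSlice_tmul]
        rw [← hα q]
        exact hα p _ c
    refine (hW (Δbar g)).trans ?_
    rw [← sliceRight_sliceRight_iterate]
    have h1 := LinearMap.congr_fun hM1 (g ⊗ₜ[k] h)
    simp only [LinearMap.comp_apply, map_tmul, LinearEquiv.coe_coe] at h1
    rw [← h1, sliceRight_sliceRight_map k
      (m := (μ.flip).compr₂ (αA.symm.toLinearMap ∘ₗ αA.symm.toLinearMap))
      (by intro f x y; simp [hΔbar])]
    refine (hα f h _).trans ?_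
    simp [← hA.1]
  · refine TensorProduct.ext' fun h a => eq_of_sliceLeft_eq k b fun f => ?_
    simp only [LinearMap.comp_apply, map_tmul, LinearEquiv.coe_coe, sliceLeft_map, hΦ]
    rw [sliceLeft_iterate_eq_sliceRight_iterate k hΦ]
    have h2 := LinearMap.congr_fun hM2 ((f ∘ₗ αA.toLinearMap) ⊗ₜ[k] h)
    simp only [LinearMap.comp_apply, map_tmul, LinearEquiv.coe_coe, hdual] at h2
    rw [← h2]
    have h₂ := sliceRight_map_dualMap k (αA a) αA.symm ΔH
      (φ ((f ∘ₗ αA.toLinearMap) ⊗ₜ[k] h))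
    simpa using h₂.symm
  · refine TensorProduct.ext' fun h a => b.ext_elem fun i => ?_
    have h3 := LinearMap.congr_fun (LinearMap.congr_fun hM3 (b.coord i ⊗ₜ[k] h)) a
    have hl : ∀ t : A ⊗[k] H, b.coord i (TensorProduct.rid k A (TensorProduct.map
        (LinearMap.id : A →ₗ[k] A) εH t)) = εH (sliceLeft k (b.coord i) t) := by
      intro t
      induction t with
      | zero => simp
      | add s t hs ht => simp only [map_add, hs, ht]
      | tmul x y => simp [mul_comm]
    have hr : ∀ t : H ⊗[k] Module.Dual k A, TensorProduct.lid k _ (TensorProduct.map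
        εH LinearMap.id t) a = εH (sliceRight k a t) := by
      intro t
      induction t with
      | zero => simp
      | add s t hs ht => simp only [map_add, LinearMap.add_apply, hs, ht]
      | tmul x y => simp [mul_comm]
    simp only [LinearMap.comp_apply, LinearEquiv.coe_coe, hr] at h3
    simp only [LinearMap.comp_apply, LinearEquiv.coe_coe, ← b.coord_apply, hl, hΦ, h3]
    simp
  · refine fun h => eq_of_sliceLeft_eq k b fun f => ?_
    rw [hΦ, sliceLeft_tmul]
    have h4 := LinearMap.congr_fun hM4 (f ⊗ₜ[k] h)
    exact h4
end
end

section
/- Let (A, α_A) be a finite-dimensional Hom-algebra and (H, α_H) a Hom-coalgebra over a field k, and let Φ : H⊗A → A⊗H be a Hom-entwining map. Let φ : A*⊗H → H⊗A* be the associated map φ(f⊗h) = Σ_i f((e_i)_Φ) h^Φ ⊗ e^i (for dual bases (e_i) of A and (e^i) of A*). Then A*⊗H, equipped with the structure map ᾱ⊗α_H, the comultiplication Δ̂(f⊗h) = Σ (f_[1] ⊗ (h₁)^φ) ⊗ ((f_[2])^φ ⊗ h₂) (where φ is applied to f_[2]⊗h₁ and f_[1]⊗f_[2] is the A*^cop-comultiplication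 of f), and the counit ε̂(f⊗h) = f(1_A)ε_H(h), is a Hom-coalgebra over k. -/
open TensorProduct BigOperators

noncomputable section

variable (k : Type*) [Field k]

section SmashCoproduct

variable {k}
variable {B H : Type*} [AddCommGroup B] [Module k B] [AddCommGroup H] [Module k H]

/-- The regrouping `(b₁ ⊗ b₂) ⊗ (h₁ ⊗ h₂) ↦ (b₁ ⊗ h₁^φ) ⊗ (b₂^φ ⊗ h₂)` underlying the smash
coproduct comultiplication. -/
def smashTwist (φ : B ⊗[k] H →ₗ[k] H ⊗[k] B) :
    (B ⊗[k] B) ⊗[k] (H ⊗[k] H) →ₗ[k] (B ⊗[k] H) ⊗[k] (B ⊗[k] H) :=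
  (TensorProduct.assoc k B H (B ⊗[k] H)).symm.toLinearMap
  ∘ₗ TensorProduct.map (LinearMap.id : B →ₗ[k] B)
       (TensorProduct.assoc k H B H).toLinearMap
  ∘ₗ TensorProduct.map (LinearMap.id : B →ₗ[k] B)
       (TensorProduct.map φ (LinearMap.id : H →ₗ[k] H))
  ∘ₗ TensorProduct.map (LinearMap.id : B →ₗ[k] B)
       (TensorProduct.assoc k B H H).symm.toLinearMap
  ∘ₗ (TensorProduct.assoc k B B (H ⊗[k] H)).toLinearMap

theorem smashComul_tmul (φ : B ⊗[k] H →ₗ[k] H ⊗[k] B) (ΔB : B →ₗ[k] B ⊗[k] B)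
    (ΔH : H →ₗ[k] H ⊗[k] H) (b : B) (h : H) :
    smashComul k φ ΔB ΔH (b ⊗ₜ h) = smashTwist φ (ΔB b ⊗ₜ ΔH h) := rfl

theorem smashTwist_tmul (φ : B ⊗[k] H →ₗ[k] H ⊗[k] B) (b c : B) (h g : H) :
    smashTwist φ ((b ⊗ₜ c) ⊗ₜ (h ⊗ₜ g)) =
      (TensorProduct.assoc k B H (B ⊗[k] H)).symm
        (b ⊗ₜ TensorProduct.assoc k H B H (φ (c ⊗ₜ h) ⊗ₜ g)) := rfl

/-- The regrouping
`(b ⊗ h) ⊗ ((h' ⊗ b') ⊗ (h'' ⊗ b'')) ↦ (b ⊗ h') ⊗ ((b' ⊗ h'') ⊗ (b'' ⊗ h))`. -/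
def smashRegroup : (B ⊗[k] H) ⊗[k] ((H ⊗[k] B) ⊗[k] (H ⊗[k] B)) →ₗ[k]
    (B ⊗[k] H) ⊗[k] ((B ⊗[k] H) ⊗[k] (B ⊗[k] H)) :=
  TensorProduct.map LinearMap.id
      ((TensorProduct.comm k (B ⊗[k] H) (B ⊗[k] H)).toLinearMap
        ∘ₗ TensorProduct.map (TensorProduct.comm k H B).toLinearMap LinearMap.id)
  ∘ₗ (TensorProduct.assoc k (B ⊗[k] H) (H ⊗[k] B) (B ⊗[k] H)).toLinearMap
  ∘ₗ TensorProduct.map (TensorProduct.tensorTensorTensorComm k B H H B).toLinearMap LinearMap.id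
  ∘ₗ (TensorProduct.assoc k (B ⊗[k] H) (H ⊗[k] B) (B ⊗[k] H)).symm.toLinearMap
  ∘ₗ TensorProduct.map LinearMap.id
      ((TensorProduct.comm k (B ⊗[k] H) (H ⊗[k] B)).toLinearMap
        ∘ₗ (TensorProduct.tensorTensorTensorComm k B H H B).toLinearMap
        ∘ₗ TensorProduct.map (TensorProduct.comm k H B).toLinearMap LinearMap.id)

theorem smashRegroup_tmul (b b' b'' : B) (h h' h'' : H) :
    smashRegroup (k := k) ((b ⊗ₜ h) ⊗ₜ ((h' ⊗ₜ b') ⊗ₜ (h'' ⊗ₜ b''))) =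
      (b ⊗ₜ h') ⊗ₜ ((b' ⊗ₜ h'') ⊗ₜ (b'' ⊗ₜ h)) := rfl

/-- The twofold iterate of `smashTwist`, as a map out of threefold tensors. -/
def smashTwist₃ (φ : B ⊗[k] H →ₗ[k] H ⊗[k] B) :
    (B ⊗[k] (B ⊗[k] B)) ⊗[k] (H ⊗[k] (H ⊗[k] H)) →ₗ[k]
      (B ⊗[k] H) ⊗[k] ((B ⊗[k] H) ⊗[k] (B ⊗[k] H)) :=
  smashRegroup
  ∘ₗ TensorProduct.map LinearMap.id
      (TensorProduct.map φ (φ ∘ₗ (TensorProduct.comm k H B).toLinearMap)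
        ∘ₗ (TensorProduct.tensorTensorTensorComm k B H H B).toLinearMap
        ∘ₗ (TensorProduct.comm k (H ⊗[k] B) (B ⊗[k] H)).toLinearMap
        ∘ₗ TensorProduct.map φ LinearMap.id
        ∘ₗ (TensorProduct.tensorTensorTensorComm k B B H H).toLinearMap
        ∘ₗ TensorProduct.map (TensorProduct.comm k B B).toLinearMap LinearMap.id)
  ∘ₗ (TensorProduct.tensorTensorTensorComm k B (B ⊗[k] B) H (H ⊗[k] H)).toLinearMap
  ∘ₗ TensorProduct.map LinearMap.id
      ((TensorProduct.comm k (H ⊗[k] H) H).toLinearMap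
        ∘ₗ (TensorProduct.assoc k H H H).symm.toLinearMap)

theorem smashTwist₃_tmul (φ : B ⊗[k] H →ₗ[k] H ⊗[k] B) (b₁ b₂ b₃ : B) (h₁ h₂ h₃ : H) :
    smashTwist₃ φ ((b₁ ⊗ₜ (b₂ ⊗ₜ b₃)) ⊗ₜ (h₁ ⊗ₜ (h₂ ⊗ₜ h₃))) =
      smashRegroup ((b₁ ⊗ₜ h₃) ⊗ₜ
        (TensorProduct.map (φ ∘ₗ TensorProduct.mk k B H b₂)
          (φ ∘ₗ (TensorProduct.mk k B H).flip h₂) (φ (b₃ ⊗ₜ h₁)))) := by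
  have key : ∀ t : H ⊗[k] B,
      TensorProduct.map φ (φ ∘ₗ (TensorProduct.comm k H B).toLinearMap)
        (TensorProduct.tensorTensorTensorComm k B H H B ((b₂ ⊗ₜ h₂) ⊗ₜ t)) =
      TensorProduct.map (φ ∘ₗ TensorProduct.mk k B H b₂)
        (φ ∘ₗ (TensorProduct.mk k B H).flip h₂) t := by
    intro t
    induction t with
    | zero => simp
    | tmul h b => simp
    | add s t hs ht => simp only [tmul_add, map_add, hs, ht]
  rw [← key]
  rfl

theorem smashTwist₃_eq_right (φ : B ⊗[k] H →ₗ[k] H ⊗[k] B) (b₁ : B) (u : B ⊗[k] B) (h₁ : H)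
    (s : H ⊗[k] H) :
    smashTwist₃ φ ((b₁ ⊗ₜ u) ⊗ₜ (h₁ ⊗ₜ s)) =
      TensorProduct.map (TensorProduct.mk k B H b₁)
        (smashTwist φ ∘ₗ (TensorProduct.mk k (B ⊗[k] B) (H ⊗[k] H)).flip s)
        (TensorProduct.assoc k H B B (TensorProduct.map φ LinearMap.id
          ((TensorProduct.assoc k B H B).symm (TensorProduct.map LinearMap.id φ
            (TensorProduct.assoc k B B H (u ⊗ₜ h₁)))))) := by
  induction s with
  | zero => simp
  | add s t hs ht =>
    simp only [tmul_add, map_add, hs, ht, LinearMap.comp_add, TensorProduct.map_add_right,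
      LinearMap.add_apply]
  | tmul h₂ h₃ =>
    induction u with
    | zero => simp
    | add s t hs ht => simp only [tmul_add, add_tmul, map_add, hs, ht]
    | tmul b₂ b₃ =>
      rw [smashTwist₃_tmul]
      simp only [TensorProduct.assoc_tmul, TensorProduct.map_tmul, LinearMap.id_apply]
      induction φ (b₃ ⊗ₜ h₁) with
      | zero => simp
      | add s t hs ht => simp only [tmul_add, map_add, hs, ht]
      | tmul h' b' =>
        simp only [TensorProduct.assoc_symm_tmul, TensorProduct.map_tmul, LinearMap.id_apply,
          LinearMap.comp_apply, TensorProduct.mk_apply, LinearMap.flip_apply]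
        induction φ (b₂ ⊗ₜ h') with
        | zero => simp
        | add s t hs ht => simp only [tmul_add, add_tmul, map_add, hs, ht]
        | tmul h'' b'' =>
          simp only [TensorProduct.assoc_tmul, TensorProduct.map_tmul, LinearMap.comp_apply,
            TensorProduct.mk_apply, LinearMap.flip_apply, smashTwist_tmul]
          induction φ (b' ⊗ₜ h₂) with
          | zero => simp
          | add s t hs ht => simp only [tmul_add, add_tmul, map_add, hs, ht]
          | tmul x y => simp [smashRegroup_tmul]

theorem smashTwist₃_eq_left (φ : B ⊗[k] H →ₗ[k] H ⊗[k] B) (u : B ⊗[k] B) (b₃ : B)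
    (s : H ⊗[k] H) (h₃ : H) :
    smashTwist₃ φ (TensorProduct.assoc k B B B (u ⊗ₜ b₃) ⊗ₜ
        TensorProduct.assoc k H H H (s ⊗ₜ h₃)) =
      TensorProduct.assoc k (B ⊗[k] H) (B ⊗[k] H) (B ⊗[k] H)
        (TensorProduct.map (smashTwist φ ∘ₗ TensorProduct.mk k (B ⊗[k] B) (H ⊗[k] H) u)
          ((TensorProduct.mk k B H).flip h₃)
          ((TensorProduct.assoc k H H B).symm (TensorProduct.map LinearMap.id φ
            (TensorProduct.assoc k H B H (TensorProduct.map φ LinearMap.id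
              ((TensorProduct.assoc k B H H).symm (b₃ ⊗ₜ s))))))) := by
  induction u with
  | zero => simp
  | add s t hs ht =>
    simp only [add_tmul, map_add, hs, ht, LinearMap.comp_add, TensorProduct.map_add_left,
      LinearMap.add_apply]
  | tmul b₁ b₂ =>
    induction s with
    | zero => simp
    | add s t hs ht => simp only [tmul_add, add_tmul, map_add, hs, ht]
    | tmul h₁ h₂ =>
      rw [TensorProduct.assoc_tmul, TensorProduct.assoc_tmul, smashTwist₃_tmul]
      simp only [TensorProduct.assoc_symm_tmul, TensorProduct.map_tmul, LinearMap.id_apply]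
      induction φ (b₃ ⊗ₜ h₁) with
      | zero => simp
      | add s t hs ht => simp only [tmul_add, add_tmul, map_add, hs, ht]
      | tmul h' b' =>
        simp only [TensorProduct.assoc_tmul, TensorProduct.map_tmul, LinearMap.id_apply,
          LinearMap.comp_apply, TensorProduct.mk_apply, LinearMap.flip_apply]
        induction φ (b' ⊗ₜ h₂) with
        | zero => simp
        | add s t hs ht => simp only [tmul_add, map_add, hs, ht]
        | tmul x y =>
          simp only [TensorProduct.assoc_symm_tmul, TensorProduct.map_tmul,
            LinearMap.comp_apply, TensorProduct.mk_apply, LinearMap.flip_apply, smashTwist_tmul]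
          induction φ (b₂ ⊗ₜ h') with
          | zero => simp
          | add s t hs ht => simp only [tmul_add, add_tmul, map_add, hs, ht]
          | tmul h'' b'' => simp [smashRegroup_tmul]

variable {αB : B ≃ₗ[k] B} {ΔB : B →ₗ[k] B ⊗[k] B} {εB : B →ₗ[k] k}
  {αH : H ≃ₗ[k] H} {ΔH : H →ₗ[k] H ⊗[k] H} {εH : H →ₗ[k] k} {φ : B ⊗[k] H →ₗ[k] H ⊗[k] B}

theorem smashTwist₃_map_comul_right
    (hM1 : TensorProduct.map αH.toLinearMap ΔB ∘ₗ φ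
      = (TensorProduct.assoc k H B B).toLinearMap
       ∘ₗ TensorProduct.map φ (LinearMap.id : B →ₗ[k] B)
       ∘ₗ (TensorProduct.assoc k B H B).symm.toLinearMap
       ∘ₗ TensorProduct.map (LinearMap.id : B →ₗ[k] B) φ
       ∘ₗ (TensorProduct.assoc k B B H).toLinearMap
       ∘ₗ TensorProduct.map ΔB αH.toLinearMap) (u : B ⊗[k] B) (s : H ⊗[k] H) :
    smashTwist₃ φ (TensorProduct.map αB.toLinearMap ΔB u ⊗ₜ
        TensorProduct.map αH.toLinearMap ΔH s) =
      TensorProduct.map (TensorProduct.congr αB αH).toLinearMap (smashComul k φ ΔB ΔH)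
        (smashTwist φ (u ⊗ₜ s)) := by
  induction u with
  | zero => simp
  | add s t hs ht => simp only [add_tmul, map_add, hs, ht]
  | tmul b₁ b₂ =>
    induction s with
    | zero => simp
    | add s t hs ht => simp only [tmul_add, map_add, hs, ht]
    | tmul h₁ h₂ =>
      have h := LinearMap.congr_fun hM1 (b₂ ⊗ₜ h₁)
      simp only [LinearMap.comp_apply, TensorProduct.map_tmul, LinearEquiv.coe_coe] at h
      simp only [TensorProduct.map_tmul, LinearEquiv.coe_coe]
      rw [smashTwist₃_eq_right, ← h, smashTwist_tmul]
      induction φ (b₂ ⊗ₜ h₁) with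
      | zero => simp
      | add s t hs ht => simp only [tmul_add, add_tmul, map_add, hs, ht]
      | tmul x y => simp [smashComul_tmul]

theorem smashTwist₃_map_comul_left
    (hM2 : TensorProduct.map ΔH αB.toLinearMap ∘ₗ φ
      = (TensorProduct.assoc k H H B).symm.toLinearMap
       ∘ₗ TensorProduct.map (LinearMap.id : H →ₗ[k] H) φ
       ∘ₗ (TensorProduct.assoc k H B H).toLinearMap
       ∘ₗ TensorProduct.map φ (LinearMap.id : H →ₗ[k] H)
       ∘ₗ (TensorProduct.assoc k B H H).symm.toLinearMap
       ∘ₗ TensorProduct.map αB.toLinearMap ΔH) (u : B ⊗[k] B) (s : H ⊗[k] H) :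
    smashTwist₃ φ (TensorProduct.assoc k B B B (TensorProduct.map ΔB αB.toLinearMap u) ⊗ₜ
        TensorProduct.assoc k H H H (TensorProduct.map ΔH αH.toLinearMap s)) =
      TensorProduct.assoc k (B ⊗[k] H) (B ⊗[k] H) (B ⊗[k] H)
        (TensorProduct.map (smashComul k φ ΔB ΔH) (TensorProduct.congr αB αH).toLinearMap
          (smashTwist φ (u ⊗ₜ s))) := by
  induction u with
  | zero => simp
  | add s t hs ht => simp only [add_tmul, map_add, hs, ht]
  | tmul b₁ b₂ =>
    induction s with
    | zero => simp
    | add s t hs ht => simp only [tmul_add, map_add, hs, ht]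
    | tmul h₁ h₂ =>
      have h := LinearMap.congr_fun hM2 (b₂ ⊗ₜ h₁)
      simp only [LinearMap.comp_apply, TensorProduct.map_tmul, LinearEquiv.coe_coe] at h
      simp only [TensorProduct.map_tmul, LinearEquiv.coe_coe]
      rw [smashTwist₃_eq_left, ← h, smashTwist_tmul]
      induction φ (b₂ ⊗ₜ h₁) with
      | zero => simp
      | add s t hs ht => simp only [tmul_add, add_tmul, map_add, hs, ht]
      | tmul x y => simp [smashComul_tmul]

theorem smashTwist_map
    (hα : φ ∘ₗ TensorProduct.map αB.toLinearMap αH.toLinearMap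
      = TensorProduct.map αH.toLinearMap αB.toLinearMap ∘ₗ φ)
    (u : B ⊗[k] B) (s : H ⊗[k] H) :
    smashTwist φ (TensorProduct.map αB.toLinearMap αB.toLinearMap u ⊗ₜ
        TensorProduct.map αH.toLinearMap αH.toLinearMap s) =
      TensorProduct.map (TensorProduct.congr αB αH).toLinearMap
        (TensorProduct.congr αB αH).toLinearMap (smashTwist φ (u ⊗ₜ s)) := by
  induction u with
  | zero => simp
  | add s t hs ht => simp only [add_tmul, map_add, hs, ht]
  | tmul b₁ b₂ =>
    induction s with
    | zero => simp
    | add s t hs ht => simp only [tmul_add, map_add, hs, ht]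
    | tmul h₁ h₂ =>
      have h := LinearMap.congr_fun hα (b₂ ⊗ₜ h₁)
      simp only [LinearMap.comp_apply, TensorProduct.map_tmul, LinearEquiv.coe_coe] at h
      simp only [TensorProduct.map_tmul, LinearEquiv.coe_coe, smashTwist_tmul, h]
      induction φ (b₂ ⊗ₜ h₁) with
      | zero => simp
      | add s t hs ht => simp only [tmul_add, add_tmul, map_add, hs, ht]
      | tmul x y => simp

theorem lid_map_smashCounit_smashTwist
    (hM3 : (TensorProduct.lid k B).toLinearMap
        ∘ₗ TensorProduct.map εH (LinearMap.id : B →ₗ[k] B) ∘ₗ φ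
      = (TensorProduct.rid k B).toLinearMap
        ∘ₗ TensorProduct.map (LinearMap.id : B →ₗ[k] B) εH)
    (u : B ⊗[k] B) (s : H ⊗[k] H) :
    TensorProduct.lid k (B ⊗[k] H) (TensorProduct.map (smashCounit k εB εH) LinearMap.id
        (smashTwist φ (u ⊗ₜ s))) =
      TensorProduct.lid k B (TensorProduct.map εB LinearMap.id u) ⊗ₜ
        TensorProduct.lid k H (TensorProduct.map εH LinearMap.id s) := by
  induction u with
  | zero => simp
  | add s t hs ht => simp only [add_tmul, map_add, hs, ht]
  | tmul b₁ b₂ =>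
    induction s with
    | zero => simp
    | add s t hs ht => simp only [tmul_add, map_add, hs, ht]
    | tmul h₁ h₂ =>
      have h := LinearMap.congr_fun hM3 (b₂ ⊗ₜ h₁)
      simp only [LinearMap.comp_apply, TensorProduct.map_tmul, LinearEquiv.coe_coe,
        LinearMap.id_apply, TensorProduct.rid_tmul] at h
      simp only [TensorProduct.map_tmul, TensorProduct.lid_tmul, LinearMap.id_apply]
      rw [tmul_smul, ← smul_tmul', smul_comm, smul_tmul', ← h, smashTwist_tmul]
      induction φ (b₂ ⊗ₜ h₁) with
      | zero => simp
      | add s t hs ht => simp only [tmul_add, add_tmul, map_add, smul_add, hs, ht]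
      | tmul x y => simp [smashCounit, mul_smul, smul_tmul']

theorem rid_map_smashCounit_smashTwist
    (hM4 : (TensorProduct.rid k H).toLinearMap
        ∘ₗ TensorProduct.map (LinearMap.id : H →ₗ[k] H) εB ∘ₗ φ
      = (TensorProduct.lid k H).toLinearMap
        ∘ₗ TensorProduct.map εB (LinearMap.id : H →ₗ[k] H))
    (u : B ⊗[k] B) (s : H ⊗[k] H) :
    TensorProduct.rid k (B ⊗[k] H) (TensorProduct.map LinearMap.id (smashCounit k εB εH)
        (smashTwist φ (u ⊗ₜ s))) =
      TensorProduct.rid k B (TensorProduct.map LinearMap.id εB u) ⊗ₜ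
        TensorProduct.rid k H (TensorProduct.map LinearMap.id εH s) := by
  induction u with
  | zero => simp
  | add s t hs ht => simp only [add_tmul, map_add, hs, ht]
  | tmul b₁ b₂ =>
    induction s with
    | zero => simp
    | add s t hs ht => simp only [tmul_add, map_add, hs, ht]
    | tmul h₁ h₂ =>
      have h := LinearMap.congr_fun hM4 (b₂ ⊗ₜ h₁)
      simp only [LinearMap.comp_apply, TensorProduct.map_tmul, LinearEquiv.coe_coe,
        LinearMap.id_apply, TensorProduct.lid_tmul] at h
      simp only [TensorProduct.map_tmul, TensorProduct.rid_tmul, LinearMap.id_apply]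
      rw [tmul_smul, smul_tmul, ← h, smashTwist_tmul]
      induction φ (b₂ ⊗ₜ h₁) with
      | zero => simp
      | add s t hs ht => simp only [tmul_add, add_tmul, map_add, smul_add, hs, ht]
      | tmul x y => simp [smashCounit, mul_smul, smul_comm (εB y)]

/-- The smash coproduct of two Hom-coalgebras along a Hom-cotwistor is a Hom-coalgebra. -/
theorem IsHomCotwistor.isHomCoalgebra_smash
    (hB : IsHomCoalgebra k αB ΔB εB) (hH : IsHomCoalgebra k αH ΔH εH)
    (hφ : IsHomCotwistor k αB ΔB εB αH ΔH εH φ) :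
    IsHomCoalgebra k (TensorProduct.congr αB αH) (smashComul k φ ΔB ΔH)
      (smashCounit k εB εH) := by
  obtain ⟨hB1, hB2, hB3, hB4, hB5⟩ := hB
  obtain ⟨hH1, hH2, hH3, hH4, hH5⟩ := hH
  obtain ⟨hα, hM1, hM2, hM3, hM4⟩ := hφ
  refine ⟨fun c => ?_, fun c => ?_, fun c => ?_, fun c => ?_, fun c => ?_⟩ <;>
    induction c with
    | zero => simp
    | add s t hs ht => simp only [map_add, hs, ht]
    | tmul b h => ?_
  · rw [TensorProduct.congr_tmul, smashComul_tmul, smashComul_tmul, hB1, hH1, smashTwist_map hα]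
  · simp [smashCounit, hB2, hH2]
  · rw [smashComul_tmul, ← smashTwist₃_map_comul_right hM1, ← smashTwist₃_map_comul_left hM2,
      hB3, hH3]
  · rw [smashComul_tmul, lid_map_smashCounit_smashTwist hM3, hB4, hH4, TensorProduct.congr_tmul]
  · rw [smashComul_tmul, rid_map_smashCounit_smashTwist hM4, hB5, hH5, TensorProduct.congr_tmul]

end SmashCoproduct

section DualCoalgebra

variable {k}
variable {A H M : Type*} [AddCommGroup A] [Module k A] [AddCommGroup H] [Module k H]
  [AddCommGroup M] [Module k M]

/-- Evaluation of the second factor of `M ⊗ A*` at `a : A`. -/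
def dualEvalRight (M : Type*) [AddCommGroup M] [Module k M] (a : A) :
    M ⊗[k] Module.Dual k A →ₗ[k] M :=
  (TensorProduct.rid k M).toLinearMap
    ∘ₗ TensorProduct.map LinearMap.id (Module.Dual.eval k A a)

@[simp]
theorem dualEvalRight_tmul (a : A) (m : M) (f : Module.Dual k A) :
    dualEvalRight M a (m ⊗ₜ[k] f) = f a • m := by
  simp [dualEvalRight]

/-- Contraction of the first factor of `A ⊗ H` with `f : A*`. -/
def contractDualLeft (H : Type*) [AddCommGroup H] [Module k H] (f : Module.Dual k A) :
    A ⊗[k] H →ₗ[k] H :=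
  (TensorProduct.lid k H).toLinearMap ∘ₗ TensorProduct.map f LinearMap.id

@[simp]
theorem contractDualLeft_tmul (f : Module.Dual k A) (a : A) (h : H) :
    contractDualLeft H f (a ⊗ₜ[k] h) = f a • h := by
  simp [contractDualLeft]

theorem dualEvalRight_ext [FiniteDimensional k A] {s t : M ⊗[k] Module.Dual k A}
    (hst : ∀ a, dualEvalRight M a s = dualEvalRight M a t) : s = t := by
  let b := Module.finBasis k A
  have expand : ∀ u : M ⊗[k] Module.Dual k A,
      u = ∑ i, dualEvalRight M (b i) u ⊗ₜ[k] b.dualBasis i := by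
    intro u
    induction u with
    | zero => simp
    | add u v hu hv =>
      simp only [map_add, add_tmul, Finset.sum_add_distrib]
      rw [← hu, ← hv]
    | tmul m f =>
      simp only [dualEvalRight_tmul, smul_tmul, ← tmul_sum]
      congr 1
      refine b.ext fun j => ?_
      simp
  rw [expand s, expand t]
  simp only [hst]

theorem dualEvalRight_dualEvalRight_assoc_symm (x y : A) (m : M)
    (u : Module.Dual k A ⊗[k] Module.Dual k A) :
    dualEvalRight M x (dualEvalRight (M ⊗[k] Module.Dual k A) y
        ((TensorProduct.assoc k M _ _).symm (m ⊗ₜ u))) =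
      TensorProduct.dualDistrib k A A u (x ⊗ₜ y) • m := by
  induction u with
  | zero => simp
  | add s t hs ht => simp only [tmul_add, map_add, hs, ht, LinearMap.add_apply, add_smul]
  | tmul f g => simp [smul_smul, mul_comm]

variable {αA : A ≃ₗ[k] A} {μ : A →ₗ[k] A →ₗ[k] A} {e : A}
  {Δbar : Module.Dual k A →ₗ[k] Module.Dual k A ⊗[k] Module.Dual k A}

theorem dualEvalRight_dualEvalRight_map_comul
    (hΔbar : ∀ (f : Module.Dual k A) (x y : A),
      TensorProduct.dualDistrib k A A (Δbar f) (x ⊗ₜ[k] y) = f (αA.symm (αA.symm (μ y x))))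
    (β : M →ₗ[k] M) (x y : A) (t : M ⊗[k] Module.Dual k A) :
    dualEvalRight M x (dualEvalRight (M ⊗[k] Module.Dual k A) y
        ((TensorProduct.assoc k M _ _).symm (TensorProduct.map β Δbar t))) =
      β (dualEvalRight M (αA.symm (αA.symm (μ y x))) t) := by
  induction t with
  | zero => simp
  | add s t hs ht => simp only [map_add, hs, ht]
  | tmul m f =>
    rw [TensorProduct.map_tmul, dualEvalRight_dualEvalRight_assoc_symm, hΔbar, dualEvalRight_tmul,
      map_smul]

theorem dualEvalRight_apply (x y : A) (u : Module.Dual k A ⊗[k] Module.Dual k A) :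
    dualEvalRight (Module.Dual k A) y u x = TensorProduct.dualDistrib k A A u (x ⊗ₜ y) := by
  induction u with
  | zero => simp
  | add s t hs ht => simp only [map_add, hs, ht, LinearMap.add_apply]
  | tmul f g => simp [mul_comm]

theorem dualDistrib_tmul_ext [FiniteDimensional k A] {s t : Module.Dual k A ⊗[k] Module.Dual k A}
    (hst : ∀ x y, TensorProduct.dualDistrib k A A s (x ⊗ₜ y) =
      TensorProduct.dualDistrib k A A t (x ⊗ₜ y)) : s = t :=
  dualEvalRight_ext fun y => LinearMap.ext fun x => by
    rw [dualEvalRight_apply, dualEvalRight_apply, hst]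

theorem dualDistrib_map_dualMap (α β : A →ₗ[k] A) (x y : A)
    (u : Module.Dual k A ⊗[k] Module.Dual k A) :
    TensorProduct.dualDistrib k A A (TensorProduct.map α.dualMap β.dualMap u) (x ⊗ₜ y) =
      TensorProduct.dualDistrib k A A u (α x ⊗ₜ β y) := by
  induction u with
  | zero => simp
  | add s t hs ht => simp only [map_add, hs, ht, LinearMap.add_apply]
  | tmul f g => simp

theorem dualEvalRight_map_dualMap {N : Type*} [AddCommGroup N] [Module k N] (γ : M →ₗ[k] N)
    (α : A →ₗ[k] A) (x : A) (u : M ⊗[k] Module.Dual k A) :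
    dualEvalRight N x (TensorProduct.map γ α.dualMap u) = γ (dualEvalRight M (α x) u) := by
  induction u with
  | zero => simp
  | add s t hs ht => simp only [map_add, hs, ht]
  | tmul f g => simp

/-- The co-opposite dual of a finite-dimensional Hom-algebra is a Hom-coalgebra. -/
theorem IsHomAlgebra.isHomCoalgebra_dual [FiniteDimensional k A] (hA : IsHomAlgebra k αA μ e)
    (hΔbar : ∀ (f : Module.Dual k A) (x y : A),
      TensorProduct.dualDistrib k A A (Δbar f) (x ⊗ₜ[k] y) = f (αA.symm (αA.symm (μ y x)))) :
    IsHomCoalgebra k αA.symm.dualMap Δbar (Module.Dual.eval k A e) := by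
  obtain ⟨hmul, hassoc, hone, hleft, hright⟩ := hA
  have hsymm : ∀ x y, αA.symm (μ x y) = μ (αA.symm x) (αA.symm y) := fun x y => by
    rw [LinearEquiv.symm_apply_eq, hmul]; simp
  have hone' : αA.symm e = e := by rw [LinearEquiv.symm_apply_eq, hone]
  have hdual : (αA.symm.dualMap).toLinearMap = αA.symm.toLinearMap.dualMap := rfl
  refine ⟨fun f => ?_, fun f => ?_, fun f => ?_, fun f => ?_, fun f => ?_⟩
  · refine dualDistrib_tmul_ext fun x y => ?_
    rw [hdual, dualDistrib_map_dualMap, hΔbar, hΔbar]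
    simp [hsymm]
  · simp [hone']
  · rw [← LinearEquiv.symm_apply_eq]
    refine dualEvalRight_ext fun z => dualEvalRight_ext fun y => LinearMap.ext fun x => ?_
    rw [dualEvalRight_dualEvalRight_map_comul hΔbar, hdual, dualEvalRight_map_dualMap,
      LinearMap.dualMap_apply, dualEvalRight_apply, dualEvalRight_apply, hΔbar, hΔbar,
      dualEvalRight_apply, hΔbar]
    have := hassoc (αA.symm (αA.symm z)) (αA.symm (αA.symm y)) (αA.symm (αA.symm x))
    simp only [LinearEquiv.apply_symm_apply] at this
    simp only [LinearEquiv.coe_coe, hsymm _ x, hsymm z, hsymm (αA.symm _) (αA.symm _), this]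
  · refine LinearMap.ext fun x => ?_
    trans TensorProduct.dualDistrib k A A (Δbar f) (e ⊗ₜ x)
    · induction Δbar f with
      | zero => simp
      | add s t hs ht => simp only [map_add, hs, ht, LinearMap.add_apply]
      | tmul f g => simp
    · simp [hΔbar, hright]
  · refine LinearMap.ext fun x => ?_
    trans TensorProduct.dualDistrib k A A (Δbar f) (x ⊗ₜ e)
    · induction Δbar f with
      | zero => simp
      | add s t hs ht => simp only [map_add, hs, ht, LinearMap.add_apply]
      | tmul f g => simp [mul_comm]
    · simp [hΔbar, hleft]

end DualCoalgebra

section Cotwistor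

variable {k}
variable {A H : Type*} [AddCommGroup A] [Module k A] [AddCommGroup H] [Module k H]
  {αA : A ≃ₗ[k] A} {μ : A →ₗ[k] A →ₗ[k] A} {e : A}
  {αH : H ≃ₗ[k] H} {ΔH : H →ₗ[k] H ⊗[k] H} {εH : H →ₗ[k] k}
  {Φ : H ⊗[k] A →ₗ[k] A ⊗[k] H}
  {Δbar : Module.Dual k A →ₗ[k] Module.Dual k A ⊗[k] Module.Dual k A}
  {φ : Module.Dual k A ⊗[k] H →ₗ[k] H ⊗[k] Module.Dual k A}

/-- The map `φ` defined by dual bases is characterised by evaluation against elements of `A`. -/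
theorem dualEvalRight_dualBasis_sum {ι : Type*} [Fintype ι] [DecidableEq ι]
    (b : Module.Basis ι k A)
    (hφ : ∀ (f : Module.Dual k A) (h : H),
      φ (f ⊗ₜ[k] h) = ∑ i, (TensorProduct.lid k H
        (TensorProduct.map (f : A →ₗ[k] k) (LinearMap.id : H →ₗ[k] H)
          (Φ (h ⊗ₜ[k] b i)))) ⊗ₜ[k] b.dualBasis i) (f : Module.Dual k A) (h : H) (a : A) :
    dualEvalRight H a (φ (f ⊗ₜ h)) = contractDualLeft H f (Φ (h ⊗ₜ a)) := by
  have key : dualEvalRight H a (φ (f ⊗ₜ h)) =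
      ∑ i, b.repr a i • contractDualLeft H f (Φ (h ⊗ₜ b i)) := by
    simp [hφ, contractDualLeft]
  conv_rhs => rw [← b.sum_repr a]
  simp only [key, tmul_sum, tmul_smul, map_sum, map_smul]

theorem contractDualLeft_map {A' N : Type*} [AddCommGroup A'] [Module k A'] [AddCommGroup N]
    [Module k N] (f : Module.Dual k A) (β : A' →ₗ[k] A) (γ : H →ₗ[k] N) (t : A' ⊗[k] H) :
    contractDualLeft N f (TensorProduct.map β γ t) = γ (contractDualLeft H (f ∘ₗ β) t) := by
  induction t with
  | zero => simp
  | add s t hs ht => simp only [map_add, hs, ht]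
  | tmul a h => simp

theorem dualEvalRight_twist_left (f : Module.Dual k A) (y : A)
    (t : H ⊗[k] Module.Dual k A) :
    dualEvalRight (H ⊗[k] Module.Dual k A) y (TensorProduct.map φ LinearMap.id
      ((TensorProduct.assoc k _ H _).symm (f ⊗ₜ t))) = φ (f ⊗ₜ dualEvalRight H y t) := by
  induction t with
  | zero => simp
  | add s t hs ht => simp only [map_add, tmul_add, hs, ht]
  | tmul h g => simp

theorem dualTensorHom_comm_apply (t : H ⊗[k] Module.Dual k A) (a : A) :
    dualTensorHom k A H (TensorProduct.comm k _ _ t) a = dualEvalRight H a t := by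
  induction t with
  | zero => simp
  | add s t hs ht => simp only [map_add, LinearMap.add_apply, hs, ht]
  | tmul h g => simp

theorem dualEvalRight_twist_right
    (hφ : ∀ (f : Module.Dual k A) (h : H) (a : A),
      dualEvalRight H a (φ (f ⊗ₜ h)) = contractDualLeft H f (Φ (h ⊗ₜ a)))
    (a : A) (h : H) (t : H ⊗[k] Module.Dual k A) :
    dualEvalRight (H ⊗[k] H) a ((TensorProduct.assoc k H H _).symm
        (TensorProduct.map LinearMap.id φ (TensorProduct.assoc k H _ H (t ⊗ₜ h)))) =
      TensorProduct.map (dualTensorHom k A H (TensorProduct.comm k _ _ t)) LinearMap.id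
        (Φ (h ⊗ₜ a)) := by
  induction t with
  | zero => simp
  | add s t hs ht =>
    simp only [map_add, add_tmul, hs, ht, TensorProduct.map_add_left, LinearMap.add_apply]
  | tmul h' g =>
    have eval_assoc : ∀ w : H ⊗[k] Module.Dual k A,
        dualEvalRight (H ⊗[k] H) a ((TensorProduct.assoc k H H _).symm (h' ⊗ₜ w)) =
          h' ⊗ₜ dualEvalRight H a w := by
      intro w
      induction w with
      | zero => simp
      | add s t hs ht => simp only [map_add, tmul_add, hs, ht]
      | tmul x y => simp
    rw [TensorProduct.assoc_tmul, TensorProduct.map_tmul, LinearMap.id_apply, eval_assoc, hφ]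
    induction Φ (h ⊗ₜ a) with
    | zero => simp
    | add s t hs ht => simp only [map_add, tmul_add, hs, ht]
    | tmul x y => simp [smul_tmul']

theorem dualEvalRight_twist_twist
    (hφ : ∀ (f : Module.Dual k A) (h : H) (a : A),
      dualEvalRight H a (φ (f ⊗ₜ h)) = contractDualLeft H f (Φ (h ⊗ₜ a)))
    (f : Module.Dual k A) (a : A) (s : H ⊗[k] H) :
    dualEvalRight (H ⊗[k] H) a ((TensorProduct.assoc k H H _).symm
        (TensorProduct.map LinearMap.id φ (TensorProduct.assoc k H _ H
          (TensorProduct.map φ LinearMap.id ((TensorProduct.assoc k _ H H).symm (f ⊗ₜ s)))))) =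
      contractDualLeft (H ⊗[k] H) f (TensorProduct.assoc k A H H
        (TensorProduct.map Φ LinearMap.id ((TensorProduct.assoc k H A H).symm
          (TensorProduct.map LinearMap.id Φ (TensorProduct.assoc k H H A (s ⊗ₜ a)))))) := by
  induction s with
  | zero => simp
  | add s t hs ht => simp only [map_add, tmul_add, add_tmul, hs, ht]
  | tmul h₁ h₂ =>
    simp only [TensorProduct.assoc_symm_tmul, TensorProduct.map_tmul, LinearMap.id_apply,
      TensorProduct.assoc_tmul]
    rw [dualEvalRight_twist_right hφ]
    induction Φ (h₂ ⊗ₜ a) with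
    | zero => simp
    | add s t hs ht => simp only [map_add, tmul_add, hs, ht]
    | tmul x y =>
      simp only [TensorProduct.assoc_symm_tmul, TensorProduct.map_tmul, LinearMap.id_apply,
        dualTensorHom_comm_apply, hφ]
      induction Φ (h₁ ⊗ₜ x) with
      | zero => simp
      | add s t hs ht => simp only [map_add, add_tmul, hs, ht]
      | tmul z w => simp [smul_tmul']

theorem contractDualLeft_twist_twist (f g : Module.Dual k A) (x : A) (w : A ⊗[k] H) :
    contractDualLeft H f (Φ (contractDualLeft H g w ⊗ₜ x)) =
      contractDualLeft H (TensorProduct.dualDistrib k A A (g ⊗ₜ f))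
        ((TensorProduct.assoc k A A H).symm (TensorProduct.map LinearMap.id Φ
          (TensorProduct.assoc k A H A (w ⊗ₜ x)))) := by
  induction w with
  | zero => simp
  | add s t hs ht => simp only [map_add, add_tmul, hs, ht]
  | tmul y h =>
    simp only [contractDualLeft_tmul, TensorProduct.assoc_tmul, TensorProduct.map_tmul,
      LinearMap.id_apply, ← smul_tmul', map_smul]
    induction Φ (h ⊗ₜ x) with
    | zero => simp
    | add s t hs ht => simp only [map_add, tmul_add, smul_add, hs, ht]
    | tmul z w => simp [smul_smul]

theorem dualEvalRight_dualEvalRight_twist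
    (hφ : ∀ (f : Module.Dual k A) (h : H) (a : A),
      dualEvalRight H a (φ (f ⊗ₜ h)) = contractDualLeft H f (Φ (h ⊗ₜ a)))
    (x y : A) (h : H) (u : Module.Dual k A ⊗[k] Module.Dual k A) :
    dualEvalRight H x (dualEvalRight (H ⊗[k] Module.Dual k A) y (TensorProduct.map φ LinearMap.id
      ((TensorProduct.assoc k _ H _).symm (TensorProduct.map LinearMap.id φ
        (TensorProduct.assoc k _ _ H (u ⊗ₜ h)))))) =
      contractDualLeft H (TensorProduct.dualDistrib k A A (TensorProduct.comm k _ _ u))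
        ((TensorProduct.assoc k A A H).symm (TensorProduct.map LinearMap.id Φ
          (TensorProduct.assoc k A H A (Φ (h ⊗ₜ y) ⊗ₜ x)))) := by
  induction u with
  | zero => simp [contractDualLeft]
  | add s t hs ht =>
    simp only [map_add, add_tmul, hs, ht]
    simp only [contractDualLeft, TensorProduct.map_add_left, LinearMap.comp_add,
      LinearMap.add_apply]
  | tmul f g =>
    rw [TensorProduct.assoc_tmul, TensorProduct.map_tmul, LinearMap.id_apply,
      dualEvalRight_twist_left, hφ, hφ, contractDualLeft_twist_twist, TensorProduct.comm_tmul]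

/-- A Hom-entwining map with finite-dimensional algebra part induces a Hom-cotwistor between the
co-opposite dual Hom-coalgebra and the given Hom-coalgebra. -/
theorem IsHomEntwining.isHomCotwistor [FiniteDimensional k A]
    (hΦ : IsHomEntwining k αA μ e αH ΔH εH Φ)
    (hΔbar : ∀ (f : Module.Dual k A) (x y : A),
      TensorProduct.dualDistrib k A A (Δbar f) (x ⊗ₜ[k] y) = f (αA.symm (αA.symm (μ y x))))
    (hφ : ∀ (f : Module.Dual k A) (h : H) (a : A),
      dualEvalRight H a (φ (f ⊗ₜ h)) = contractDualLeft H f (Φ (h ⊗ₜ a))) :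
    IsHomCotwistor k αA.symm.dualMap Δbar (Module.Dual.eval k A e) αH ΔH εH φ := by
  obtain ⟨hα, hE1, hE2, hE3, hE4⟩ := hΦ
  have hdual : (αA.symm.dualMap).toLinearMap = αA.symm.toLinearMap.dualMap := rfl
  have hcancel : αA.symm.toLinearMap ∘ₗ αA.toLinearMap = LinearMap.id := by ext; simp
  have hα' : ∀ h a, Φ (αH h ⊗ₜ a) =
      TensorProduct.map αA.toLinearMap αH.toLinearMap (Φ (h ⊗ₜ αA.symm a)) := fun h a => by
    have := LinearMap.congr_fun hα (h ⊗ₜ αA.symm a)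
    simpa using this.symm
  refine ⟨?_, ?_, ?_, ?_, ?_⟩ <;> refine TensorProduct.ext' fun f h => ?_
  · refine dualEvalRight_ext fun a => ?_
    rw [LinearMap.comp_apply, LinearMap.comp_apply, TensorProduct.map_tmul, hdual,
      dualEvalRight_map_dualMap, hφ, hφ]
    simp only [LinearEquiv.coe_coe, hα', contractDualLeft_map, LinearMap.dualMap_apply']
    rw [LinearMap.comp_assoc, hcancel, LinearMap.comp_id]
  · simp only [LinearMap.comp_apply, LinearEquiv.coe_coe, TensorProduct.map_tmul]
    rw [← LinearEquiv.symm_apply_eq]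
    refine dualEvalRight_ext fun y => dualEvalRight_ext fun x => ?_
    rw [dualEvalRight_dualEvalRight_map_comul hΔbar, dualEvalRight_dualEvalRight_twist hφ, hφ]
    have hcomul : TensorProduct.dualDistrib k A A (TensorProduct.comm k _ _ (Δbar f)) =
        (f ∘ₗ αA.symm.toLinearMap ∘ₗ αA.symm.toLinearMap) ∘ₗ TensorProduct.lift μ := by
      refine TensorProduct.ext' fun a c => ?_
      simp only [LinearMap.comp_apply, TensorProduct.lift.tmul, LinearEquiv.coe_coe, ← hΔbar]
      induction Δbar f with
      | zero => simp
      | add s t hs ht => simp only [map_add, LinearMap.add_apply, hs, ht]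
      | tmul f g => simp [mul_comm]
    have h1 := LinearMap.congr_fun hE1 ((αH h ⊗ₜ y) ⊗ₜ x)
    simp only [LinearMap.comp_apply, LinearEquiv.coe_coe, TensorProduct.map_tmul,
      LinearMap.id_apply, TensorProduct.assoc_tmul, TensorProduct.lift.tmul] at h1
    apply αH.injective
    have hf : ((f ∘ₗ αA.symm.toLinearMap ∘ₗ αA.symm.toLinearMap) ∘ₗ αA.toLinearMap)
        ∘ₗ αA.toLinearMap = f := by ext; simp
    change αH (αH _) = αH.toLinearMap _
    rw [hcomul, ← contractDualLeft_map, h1, hα', contractDualLeft_map, hα',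
      contractDualLeft_map, hf]
    rfl
  · simp only [LinearMap.comp_apply, LinearEquiv.coe_coe, TensorProduct.map_tmul]
    refine dualEvalRight_ext fun a => ?_
    rw [dualEvalRight_twist_twist hφ, hdual, dualEvalRight_map_dualMap, hφ]
    have h2 := LinearMap.congr_fun hE2 (h ⊗ₜ αA.symm a)
    simp only [LinearMap.comp_apply, LinearEquiv.coe_coe, TensorProduct.map_tmul,
      LinearEquiv.apply_symm_apply] at h2
    rw [← h2, contractDualLeft_map]
    have hf : αA.symm.dualMap f ∘ₗ αA.toLinearMap = f := by ext; simp
    rw [hf]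
    rfl
  · refine LinearMap.ext fun a => ?_
    have h3 := congrArg f (LinearMap.congr_fun hE3 (h ⊗ₜ a))
    simp only [LinearMap.comp_apply, LinearEquiv.coe_coe, TensorProduct.map_tmul,
      LinearMap.id_apply, TensorProduct.lid_tmul, TensorProduct.rid_tmul, map_smul] at h3 ⊢
    rw [LinearMap.smul_apply, ← h3]
    trans εH (dualEvalRight H a (φ (f ⊗ₜ h)))
    · induction φ (f ⊗ₜ h) with
      | zero => simp
      | add s t hs ht => simp only [map_add, LinearMap.add_apply, hs, ht]
      | tmul x y => simp [mul_comm]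
    · rw [hφ]
      induction Φ (h ⊗ₜ a) with
      | zero => simp
      | add s t hs ht => simp only [map_add, hs, ht]
      | tmul x y => simp [mul_comm]
  · change dualEvalRight H e (φ (f ⊗ₜ h)) = _
    rw [hφ, hE4]
    simp

end Cotwistor

/-- for a Hom-entwining structure `(H, A, Φ)` with `A`
finite-dimensional, the smash coproduct `A*^cop ⊗ H` (via the associated
cotwistor `φ`) is a Hom-coalgebra. -/
theorem homEntwining_smashCoproduct_isHomCoalgebra
    {A H : Type*} [AddCommGroup A] [Module k A] [AddCommGroup H] [Module k H]
    [FiniteDimensional k A]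
    {ι : Type*} [Fintype ι] [DecidableEq ι] (b : Module.Basis ι k A)
    (αA : A ≃ₗ[k] A) (μ : A →ₗ[k] A →ₗ[k] A) (e : A)
    (αH : H ≃ₗ[k] H) (ΔH : H →ₗ[k] H ⊗[k] H) (εH : H →ₗ[k] k)
    (hA : IsHomAlgebra k αA μ e) (hH : IsHomCoalgebra k αH ΔH εH)
    (Φ : H ⊗[k] A →ₗ[k] A ⊗[k] H)
    (hΦ : IsHomEntwining k αA μ e αH ΔH εH Φ)
    (Δbar : Module.Dual k A →ₗ[k] Module.Dual k A ⊗[k] Module.Dual k A)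
    (hΔbar : ∀ (f : Module.Dual k A) (x y : A),
        TensorProduct.dualDistrib k A A (Δbar f) (x ⊗ₜ[k] y)
          = f (αA.symm (αA.symm (μ y x))))
    (φ : Module.Dual k A ⊗[k] H →ₗ[k] H ⊗[k] Module.Dual k A)
    (hφ : ∀ (f : Module.Dual k A) (h : H),
        φ (f ⊗ₜ[k] h) = ∑ i, (TensorProduct.lid k H
            (TensorProduct.map (f : A →ₗ[k] k) (LinearMap.id : H →ₗ[k] H)
              (Φ (h ⊗ₜ[k] b i)))) ⊗ₜ[k] b.dualBasis i) :
    IsHomCoalgebra (C := Module.Dual k A ⊗[k] H) k (TensorProduct.congr αA.symm.dualMap αH)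
      (smashComul k φ Δbar ΔH)
      (smashCounit k (Module.Dual.eval k A e) εH) := by
  exact IsHomCotwistor.isHomCoalgebra_smash (hA.isHomCoalgebra_dual hΔbar) hH
    (hΦ.isHomCotwistor hΔbar (dualEvalRight_dualBasis_sum b hφ))
end
end
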